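/- Let n ≥ 1 and let (φ_k) be a sequence of symplectomorphisms of (ℝ^{2n}, ω₀) that converges locally uniformly (i.e. uniformly on compact sets) to a map φ : ℝ^{2n} → ℝ^{2n} which is itself a smooth diffeomorphism of ℝ^{2n}. Then φ is a symplectomorphism of (ℝ^{2n}, ω₀). (C⁰-rigidity: the symplectomorphisms form a C⁰-closed subset of the diffeomorphisms.) -/

import Mathlib

/-- The standard symplectic bilinear form `ω₀` on `ℝ^{2n}`:
`ω₀(v,w) = Σ_{i=1}^{n} (v_{2i−1} w_{2i} − v_{2i} w_{2i−1})` (here indexed from 0). -/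
noncomputable def stdSymplecticForm (n : ℕ) (v w : Fin (2 * n) → ℝ) : ℝ :=
  ∑ i : Fin n,
    (v ⟨2 * i, by have := i.isLt; omega⟩ * w ⟨2 * i + 1, by have := i.isLt; omega⟩
      - v ⟨2 * i + 1, by have := i.isLt; omega⟩ * w ⟨2 * i, by have := i.isLt; omega⟩)

/-- A smooth diffeomorphism of `ℝ^{2n}`: a smooth bijection with smooth inverse. -/
def IsSmoothDiffeo (n : ℕ) (φ : (Fin (2 * n) → ℝ) → (Fin (2 * n) → ℝ)) : Prop :=
  ContDiff ℝ (⊤ : ℕ∞) φ ∧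
    ∃ ψ : (Fin (2 * n) → ℝ) → (Fin (2 * n) → ℝ),
      ContDiff ℝ (⊤ : ℕ∞) ψ ∧ Function.LeftInverse ψ φ ∧ Function.RightInverse ψ φ

/-- A symplectomorphism of `(ℝ^{2n}, ω₀)`: a smooth diffeomorphism whose derivative
preserves `ω₀` at every point. -/
def IsSymplectomorphism (n : ℕ) (φ : (Fin (2 * n) → ℝ) → (Fin (2 * n) → ℝ)) : Prop :=
  IsSmoothDiffeo n φ ∧
    ∀ (x v w : Fin (2 * n) → ℝ),
      stdSymplecticForm n (fderiv ℝ φ x v) (fderiv ℝ φ x w) = stdSymplecticForm n v w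

section CZeroRigidity

open Set Filter Topology MeasureTheory
open scoped ContDiff NNReal RealInnerProductSpace

/-- A map that is `C¹`-close to the identity is a homeomorphism with differentiable inverse. -/
theorem exists_homeomorph_of_norm_fderiv_sub_id_le {E : Type*} [NormedAddCommGroup E]
    [NormedSpace ℝ E] [CompleteSpace E] {n : WithTop ℕ∞} (hn : n ≠ 0) {g : E → E}
    (hg : ContDiff ℝ n g) (h : ∀ x, ‖fderiv ℝ g x - ContinuousLinearMap.id ℝ E‖ ≤ 1 / 2) :
    ∃ e : E ≃ₜ E, ⇑e = g ∧ ContDiff ℝ n e.symm := by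
  have hd : Differentiable ℝ g := hg.differentiable hn
  have happ : ApproximatesLinearOn g
      ((ContinuousLinearEquiv.refl ℝ E : E ≃L[ℝ] E) : E →L[ℝ] E) univ (1 / 2) := by
    intro x _ y _
    have := (convex_univ (𝕜 := ℝ) (E := E)).norm_image_sub_le_of_norm_hasFDerivWithin_le
      (f := fun z => g z - z) (f' := fun z => fderiv ℝ g z - ContinuousLinearMap.id ℝ E)
      (C := 1 / 2) (fun z _ => ((hd z).hasFDerivAt.sub (hasFDerivAt_id z)).hasFDerivWithinAt)
      (fun z _ => h z) (mem_univ y) (mem_univ x)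
    convert this using 2
    · simp; abel
    · norm_num
  have hc : Subsingleton E ∨ (1 / 2 : ℝ≥0) <
      ‖((ContinuousLinearEquiv.refl ℝ E).symm : E →L[ℝ] E)‖₊⁻¹ := by
    rcases subsingleton_or_nontrivial E with h | h
    · exact Or.inl h
    · right
      have : ‖((ContinuousLinearEquiv.refl ℝ E).symm : E →L[ℝ] E)‖₊ = 1 := by
        ext; exact ContinuousLinearMap.norm_id
      rw [this, inv_one]
      rw [← NNReal.coe_lt_coe]; norm_num
  let e := happ.toHomeomorph g hc
  have he : ⇑e = g := rfl
  have hlt : ∀ a, ‖1 - fderiv ℝ g a‖ < 1 := fun a => by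
    rw [norm_sub_rev]; exact (h a).trans_lt (by norm_num)
  refine ⟨e, he, e.contDiff_symm
    (f₀' := fun a => ContinuousLinearEquiv.unitsEquiv ℝ E (Units.oneSub _ (hlt a))) ?_ (he ▸ hg)⟩
  intro a
  convert (hd a).hasFDerivAt using 1
  ext v
  simp

theorem exists_polynomial_eval_eq_det {A : Type*} [NormedAddCommGroup A] [NormedSpace ℝ A]
    [FiniteDimensional ℝ A] (L : A →L[ℝ] A) :
    ∃ p : Polynomial ℝ, p.natDegree ≤ Module.finrank ℝ A ∧
      ∀ t : ℝ, p.eval t = (ContinuousLinearMap.id ℝ A + t • L).det := by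
  classical
  let b := Module.finBasis ℝ A
  let M := LinearMap.toMatrix b b (L : A →ₗ[ℝ] A)
  refine ⟨((Polynomial.X : Polynomial ℝ) • M.map Polynomial.C +
    (1 : Matrix _ _ ℝ).map Polynomial.C).det, ?_, fun t => ?_⟩
  · simpa using Polynomial.natDegree_det_X_add_C_le M 1
  · rw [Polynomial.eval, ← Polynomial.coe_eval₂RingHom, RingHom.map_det]
    rw [ContinuousLinearMap.det, ← LinearMap.det_toMatrix b]
    congr 1
    ext i j
    simp [M, Matrix.one_apply, LinearMap.toMatrix_apply, Finsupp.single_apply, eq_comm, add_comm]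
    split_ifs <;> simp [mul_comm]

theorem exists_polynomial_eval_eq_weight_mul_det {A : Type*} [NormedAddCommGroup A]
    [InnerProductSpace ℝ A] [FiniteDimensional ℝ A] (L : A →L[ℝ] A) (x b : A) (c : ℝ) (k : ℕ) :
    ∃ p : Polynomial ℝ, p.natDegree ≤ k * 2 + Module.finrank ℝ A ∧
      ∀ t : ℝ, p.eval t =
        (c - ‖x + t • b‖ ^ 2) ^ k * (ContinuousLinearMap.id ℝ A + t • L).det := by
  obtain ⟨p, hp, hpe⟩ := exists_polynomial_eval_eq_det L
  refine ⟨(Polynomial.C (c - ‖x‖ ^ 2) - Polynomial.C (2 * inner ℝ x b) * Polynomial.X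
    - Polynomial.C (‖b‖ ^ 2) * Polynomial.X ^ 2) ^ k * p, ?_, fun t => ?_⟩
  · refine Polynomial.natDegree_mul_le_of_le (Polynomial.natDegree_pow_le_of_le k ?_) hp
    compute_degree
  · simp only [Polynomial.eval_mul, Polynomial.eval_pow, Polynomial.eval_sub, Polynomial.eval_C,
      Polynomial.eval_X, hpe]
    congr 2
    rw [norm_add_sq_real, norm_smul, inner_smul_right, mul_pow, Real.norm_eq_abs, sq_abs]
    ring

/-- A relation between the values of a polynomial of degree at most `d` at small nodes and
its value at `1`. -/
theorem exists_interpolation_weights (d : ℕ) {t₀ : ℝ} (ht₀ : 0 < t₀) :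
    ∃ (v w : Fin (d + 1) → ℝ), (∀ i, v i ∈ Icc 0 t₀) ∧ ∑ i, w i = 1 ∧
      ∀ p : Polynomial ℝ, p.natDegree ≤ d → p.eval 1 = ∑ i, w i * p.eval (v i) := by
  let v : Fin (d + 1) → ℝ := fun i => t₀ * (i / (d + 1))
  have hinj : InjOn v ((Finset.univ : Finset (Fin (d + 1))) : Set (Fin (d + 1))) := by
    intro i _ j _ hij
    have : (0 : ℝ) < d + 1 := by positivity
    simp only [v] at hij
    field_simp at hij
    exact Fin.ext (by exact_mod_cast hij)
  refine ⟨v, fun i => (Lagrange.basis Finset.univ v i).eval 1, fun i => ⟨by positivity, ?_⟩, ?_, ?_⟩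
  · have : (i : ℝ) / (d + 1) ≤ 1 := by
      rw [div_le_one (by positivity)]; exact_mod_cast i.isLt.le
    exact mul_le_of_le_one_right ht₀.le this
  · rw [← Polynomial.eval_finsetSum, Lagrange.sum_basis hinj ⟨0, Finset.mem_univ _⟩,
      Polynomial.eval_one]
  · intro p hp
    have hdeg : p.degree < (Finset.univ : Finset (Fin (d + 1))).card := by
      refine Polynomial.degree_le_natDegree.trans_lt ?_
      simp only [Finset.card_univ, Fintype.card_fin]
      exact_mod_cast Nat.lt_succ_of_le hp
    conv_lhs => rw [Lagrange.eq_interpolate hinj hdeg, Lagrange.interpolate_apply,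
      Polynomial.eval_finsetSum]
    simp [mul_comm]

theorem exists_pos_forall_det_pos {A : Type*} [NormedAddCommGroup A]
    [NormedSpace ℝ A] [FiniteDimensional ℝ A] :
    ∃ δ > 0, ∀ M : A →L[ℝ] A, ‖M - ContinuousLinearMap.id ℝ A‖ < δ → 0 < M.det := by
  have h1 : (ContinuousLinearMap.id ℝ A).det = 1 := by
    simp [ContinuousLinearMap.det]
  have := (ContinuousLinearMap.continuous_det (𝕜 := ℝ) (E := A)).continuousAt
    (x := ContinuousLinearMap.id ℝ A) |>.eventually (lt_mem_nhds (show (0:ℝ) < (ContinuousLinearMap.id ℝ A).det by rw [h1]; norm_num))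
  obtain ⟨δ, hδ, h⟩ := Metric.eventually_nhds_iff.1 this
  exact ⟨δ, hδ, fun M hM => h (by rwa [dist_eq_norm])⟩

/-- The weighted degree formula for the identity plus a compactly supported map. -/
theorem setIntegral_weight_mul_det_eq {A : Type*} [NormedAddCommGroup A]
    [InnerProductSpace ℝ A] [FiniteDimensional ℝ A] [MeasurableSpace A] [BorelSpace A]
    (μ : Measure A) [μ.IsAddHaarMeasure] {b : A → A} (hb : ContDiff ℝ 1 b) {R : ℝ}
    (hR : ∀ x, R < ‖x‖ → b x = 0) (c : ℝ) (k : ℕ) :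
    ∫ x in Metric.closedBall 0 R,
      (c - ‖x + b x‖ ^ 2) ^ k * (ContinuousLinearMap.id ℝ A + fderiv ℝ b x).det ∂μ =
    ∫ x in Metric.closedBall 0 R, (c - ‖x‖ ^ 2) ^ k ∂μ := by
  set B : Set A := Metric.closedBall 0 R
  have hmem : ∀ x, x ∈ B ↔ ‖x‖ ≤ R := fun x => by simp [B]
  have hBc : IsCompact B := isCompact_closedBall _ _
  have hsupp : HasCompactSupport b := HasCompactSupport.intro hBc fun x hx =>
    hR x (by simpa [hmem] using hx)
  have hcd : Continuous (fderiv ℝ b) := hb.continuous_fderiv one_ne_zero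
  obtain ⟨K, hK⟩ := (hsupp.fderiv ℝ).exists_bound_of_continuous hcd
  obtain ⟨δ, hδ, hdet⟩ := exists_pos_forall_det_pos (A := A)
  have hK0 : 0 ≤ K := (norm_nonneg _).trans (hK 0)
  obtain ⟨t₀, ht₀, htK⟩ : ∃ t₀ > 0, t₀ * K < min δ (1 / 2) := by
    have hm : 0 < min δ (1 / 2) := by positivity
    refine ⟨min δ (1 / 2) / (K + 1), by positivity, ?_⟩
    rw [div_mul_eq_mul_div, div_lt_iff₀ (by positivity)]
    nlinarith
  let J : ℝ → A → ℝ := fun t x =>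
    (c - ‖x + t • b x‖ ^ 2) ^ k * (ContinuousLinearMap.id ℝ A + t • fderiv ℝ b x).det
  have hJc : ∀ t, Continuous (J t) := fun t => by
    have := hb.continuous
    refine Continuous.mul (by fun_prop) (ContinuousLinearMap.continuous_det.comp (by fun_prop))
  have hsmall : ∀ t ∈ Icc 0 t₀, ∫ x in B, J t x ∂μ = ∫ x in B, (c - ‖x‖ ^ 2) ^ k ∂μ := by
    intro t ht
    let g : A → A := fun x => x + t • b x
    have hder : ∀ x, HasFDerivAt g (ContinuousLinearMap.id ℝ A + t • fderiv ℝ b x) x := fun x =>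
      (hasFDerivAt_id x).add (((hb.differentiable one_ne_zero) x).hasFDerivAt.const_smul t)
    have hn : ∀ x, ‖ContinuousLinearMap.id ℝ A + t • fderiv ℝ b x - ContinuousLinearMap.id ℝ A‖
        < min δ (1 / 2) := fun x => by
      rw [add_sub_cancel_left, norm_smul, Real.norm_eq_abs, abs_of_nonneg ht.1]
      exact (mul_le_mul ht.2 (hK x) (norm_nonneg _) ht₀.le).trans_lt htK
    obtain ⟨e, he, -⟩ := exists_homeomorph_of_norm_fderiv_sub_id_le one_ne_zero
      (g := g) (contDiff_id.add (hb.const_smul t)) fun x => by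
        rw [(hder x).fderiv]; exact ((hn x).trans_le (min_le_right _ _)).le
    have hout : ∀ x, x ∉ B → g x = x := fun x hx => by
      simp [g, hR x (by simpa [hmem] using hx)]
    have hinj : Function.Injective g := he ▸ e.injective
    have himg : g '' B = B := by
      ext y
      constructor
      · rintro ⟨x, hx, rfl⟩
        by_contra hy
        exact hy ((hinj (hout _ hy)).symm ▸ hx)
      · intro hy
        obtain ⟨x, rfl⟩ : ∃ x, g x = y := by rw [← he]; exact e.surjective y
        by_cases hx : x ∈ B
        · exact ⟨x, hx, rfl⟩
        · exact absurd (hout x hx ▸ hy) hx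
    have := integral_image_eq_integral_abs_det_fderiv_smul μ hBc.measurableSet
      (fun x _ => (hder x).hasFDerivWithinAt) hinj.injOn (fun y => (c - ‖y‖ ^ 2) ^ k)
    rw [himg] at this
    rw [this]
    refine integral_congr_ae (Eventually.of_forall fun x => ?_)
    simp only [J, g, smul_eq_mul]
    rw [abs_of_pos (hdet _ ((hn x).trans_le (min_le_left _ _))), mul_comm]
  obtain ⟨v, w, hv, hw, hp⟩ := exists_interpolation_weights (k * 2 + Module.finrank ℝ A) ht₀
  have h1 : ∀ x, J 1 x = ∑ i, w i * J (v i) x := fun x => by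
    obtain ⟨p, hpd, hpe⟩ := exists_polynomial_eval_eq_weight_mul_det (fderiv ℝ b x) x (b x) c k
    have := hp p hpd
    simp only [hpe] at this
    simpa only [J] using this
  calc _ = ∫ x in B, J 1 x ∂μ := by simp [J]
    _ = ∑ i, w i * ∫ x in B, J (v i) x ∂μ := by
      simp_rw [h1]
      rw [integral_finsetSum _ fun i _ =>
        (((hJc _).continuousOn.integrableOn_compact hBc).const_mul _)]
      simp_rw [integral_const_mul]
    _ = _ := by
      simp_rw [hsmall _ (hv _)]
      rw [← Finset.sum_mul, hw, one_mul]

theorem exists_add_eq_zero_of_eq_zero_of_lt_norm {A : Type*} [NormedAddCommGroup A]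
    [InnerProductSpace ℝ A] [FiniteDimensional ℝ A] {b : A → A} (hb : ContDiff ℝ 1 b) {R : ℝ}
    (hR : ∀ x, R < ‖x‖ → b x = 0) : ∃ v, v + b v = 0 := by
  by_contra! h
  borelize A
  let μ : Measure A := Measure.addHaar
  set B : Set A := Metric.closedBall 0 R with hB
  have hBc : IsCompact B := isCompact_closedBall _ _
  have hcG : Continuous fun x => x + b x := continuous_id.add hb.continuous
  have hR0 : 0 < R := by
    by_contra! hn
    refine h 0 ?_
    by_contra h0
    have : ∀ᶠ x in 𝓝[≠] (0 : A), b x = 0 := by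
      filter_upwards [self_mem_nhdsWithin] with x hx
      exact hR x (hn.trans_lt (norm_pos_iff.2 hx))
    rw [zero_add] at h0
    have : Nontrivial A := ⟨⟨b 0, 0, h0⟩⟩
    have : (𝓝[≠] (0 : A)).NeBot := Module.punctured_nhds_neBot ℝ A 0
    exact h0 (tendsto_nhds_unique (hb.continuous.continuousAt.mono_left nhdsWithin_le_nhds)
      (tendsto_const_nhds.congr' (by filter_upwards [‹∀ᶠ x in 𝓝[≠] (0 : A), b x = 0›] with x hx
                                     exact hx.symm)))
  obtain ⟨x₀, hx₀, hmin⟩ := hBc.exists_isMinOn ⟨0, by simp [hB, hR0.le]⟩ hcG.norm.continuousOn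
  obtain ⟨D, hD⟩ := hBc.exists_bound_of_continuousOn hcG.continuousOn
  set r := min ‖x₀ + b x₀‖ R
  have hr : 0 < r := lt_min (norm_pos_iff.2 (h x₀)) hR0
  have hrB : ∀ x ∈ B, r ≤ ‖x + b x‖ := fun x hx => (min_le_left _ _).trans (hmin hx)
  set c := (max D R) ^ 2
  have hcd : Continuous fun x => (ContinuousLinearMap.id ℝ A + fderiv ℝ b x).det :=
    ContinuousLinearMap.continuous_det.comp
      (continuous_const.add (hb.continuous_fderiv one_ne_zero))
  obtain ⟨C, hC⟩ := hBc.exists_bound_of_continuousOn hcd.continuousOn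
  set q := c - r ^ 2
  set q' := c - (r / 2) ^ 2
  have hrc : r ^ 2 ≤ c := by
    have : r ≤ max D R := (min_le_right _ _).trans (le_max_right _ _)
    exact pow_le_pow_left₀ hr.le this 2
  have hq : 0 ≤ q := by simp only [q]; linarith
  have hqq : q < q' := by simp only [q, q']; nlinarith
  have hC0 : 0 ≤ C := (norm_nonneg _).trans (hC x₀ hx₀)
  have hupper : ∀ k : ℕ, ∫ x in B, (c - ‖x‖ ^ 2) ^ k ∂μ ≤ q ^ k * C * μ.real B := by
    intro k
    rw [← setIntegral_weight_mul_det_eq μ hb hR c k]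
    refine (le_abs_self _).trans ?_
    rw [← Real.norm_eq_abs]
    refine norm_setIntegral_le_of_norm_le_const hBc.measure_lt_top fun x hx => ?_
    rw [norm_mul]
    refine mul_le_mul ?_ (hC x hx) (norm_nonneg _) (by positivity)
    rw [norm_pow]
    refine pow_le_pow_left₀ (norm_nonneg _) ?_ k
    have h1 : ‖x + b x‖ ^ 2 ≤ c :=
      pow_le_pow_left₀ (norm_nonneg _) ((hD x hx).trans (le_max_left _ _)) 2
    rw [Real.norm_eq_abs, abs_of_nonneg (by linarith)]
    have := pow_le_pow_left₀ hr.le (hrB x hx) 2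
    simp only [q]; linarith
  have hlower : ∀ k : ℕ, q' ^ k * μ.real (Metric.closedBall 0 (r / 2)) ≤
      ∫ x in B, (c - ‖x‖ ^ 2) ^ k ∂μ := by
    intro k
    have hsub : Metric.closedBall (0 : A) (r / 2) ⊆ B :=
      Metric.closedBall_subset_closedBall (by linarith [min_le_right ‖x₀ + b x₀‖ R])
    have hint : IntegrableOn (fun x : A => (c - ‖x‖ ^ 2) ^ k) B μ :=
      (by fun_prop : Continuous fun x : A => (c - ‖x‖ ^ 2) ^ k).continuousOn.integrableOn_compact hBc
    refine le_trans ?_ (setIntegral_mono_set hint ?_ hsub.eventuallyLE)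
    · rw [mul_comm, ← smul_eq_mul, ← setIntegral_const]
      refine setIntegral_mono_on (integrableOn_const (isCompact_closedBall _ _).measure_lt_top.ne)
        (hint.mono_set hsub) (isCompact_closedBall _ _).measurableSet fun x hx => ?_
      refine pow_le_pow_left₀ (hq.trans hqq.le) ?_ k
      have : ‖x‖ ≤ r / 2 := by simpa using hx
      have := pow_le_pow_left₀ (norm_nonneg _) this 2
      simp only [q']; linarith
    · refine (ae_restrict_iff' hBc.measurableSet).2 (Eventually.of_forall fun x hx => ?_)
      have : ‖x‖ ≤ max D R := (by simpa [hB] using hx : ‖x‖ ≤ R).trans (le_max_right _ _)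
      have := pow_le_pow_left₀ (norm_nonneg _) this 2
      exact pow_nonneg (by simp only [c]; linarith) k
  have hm : 0 < μ.real (Metric.closedBall (0 : A) (r / 2)) := by
    refine ENNReal.toReal_pos (Metric.measure_closedBall_pos μ _ (by positivity)).ne'
      (isCompact_closedBall _ _).measure_lt_top.ne
  have hq'0 : 0 < q' := hq.trans_lt hqq
  have hlim : Tendsto (fun k : ℕ => (q / q') ^ k * (C * μ.real B)) atTop (𝓝 (0 * (C * μ.real B))) :=
    (tendsto_pow_atTop_nhds_zero_of_lt_one (by positivity)
      ((div_lt_one hq'0).2 hqq)).mul_const _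
  rw [zero_mul] at hlim
  refine absurd (ge_of_tendsto' hlim fun k => ?_) (not_le.2 hm)
  have := (hlower k).trans (hupper k)
  rw [div_pow, div_mul_eq_mul_div, le_div_iff₀ (by positivity)]
  linarith

/-- A bounded continuously differentiable perturbation of the identity has a zero. -/
theorem exists_add_eq_zero_of_bounded {A : Type*} [NormedAddCommGroup A]
    [InnerProductSpace ℝ A] [FiniteDimensional ℝ A] {b : A → A} (hb : ContDiff ℝ 1 b) {C : ℝ}
    (hC : ∀ x, ‖b x‖ ≤ C) : ∃ v, v + b v = 0 := by
  have hC0 : 0 ≤ C := (norm_nonneg _).trans (hC 0)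
  let χ : ContDiffBump (0 : A) := ⟨C + 1, C + 2, by linarith, by linarith⟩
  obtain ⟨v, hv⟩ := exists_add_eq_zero_of_eq_zero_of_lt_norm (b := fun x => χ x • b x)
    (χ.contDiff.smul hb) (R := C + 2) fun x hx => by
      rw [χ.zero_of_le_dist (by simpa [χ] using hx.le), zero_smul]
  refine ⟨v, ?_⟩
  have hvn : ‖v‖ ≤ C := by
    rw [eq_neg_of_add_eq_zero_left hv, norm_neg, norm_smul, Real.norm_eq_abs,
      abs_of_nonneg χ.nonneg]
    exact (mul_le_of_le_one_left (norm_nonneg _) χ.le_one).trans (hC v)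
  rwa [χ.one_of_mem_closedBall (by simpa [χ] using hvn.trans (by linarith)), one_smul] at hv

theorem contDiff_iterate {E : Type*} [NormedAddCommGroup E] [NormedSpace ℝ E] {n : WithTop ℕ∞}
    {f : E → E} (hf : ContDiff ℝ n f) (M : ℕ) : ContDiff ℝ n f^[M] := by
  induction M with
  | zero => exact contDiff_id
  | succ M ih => exact ih.comp hf

/-- Descent along an explicit gradient step. -/
theorem image_sub_smul_le_of_lipschitz_fderiv {E : Type*} [NormedAddCommGroup E] [NormedSpace ℝ E]
    {F : E → ℝ} {F' : E → E →L[ℝ] ℝ} (hF : ∀ z, HasFDerivAt F (F' z) z) {L : ℝ}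
    (hL : ∀ z w, ‖F' z - F' w‖ ≤ L * ‖z - w‖) (hL0 : 0 ≤ L) {ε : ℝ} (hε : 0 ≤ ε)
    (hεL : ε * L ≤ 1 / 2) {z G : E} {Q : ℝ} (hQ : F' z G = Q) (hG : ‖G‖ ^ 2 ≤ Q) :
    F (z - ε • G) ≤ F z - ε / 2 * Q := by
  have hder : ∀ t : ℝ, HasDerivAt (fun t => F (z - t • G)) (-(F' (z - t • G) G)) t := fun t => by
    have h1 : HasDerivAt (fun t : ℝ => z - t • G) (-((1 : ℝ) • G)) t :=
      ((hasDerivAt_id t).smul_const G).const_sub z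
    have := (hF (z - t • G)).comp_hasDerivAt t h1
    simpa [Function.comp_def] using this
  have := Convex.image_sub_le_mul_sub_of_deriv_le (convex_Icc 0 ε)
    (f := fun t => F (z - t • G)) (fun t _ => (hder t).continuousAt.continuousWithinAt)
    (fun t _ => (hder t).differentiableAt.differentiableWithinAt) (C := -(Q / 2)) (fun t ht => by
      rw [interior_Icc] at ht
      rw [(hder t).deriv]
      have h1 : |(F' (z - t • G) - F' z) G| ≤ L * (t * ‖G‖) * ‖G‖ := by
        rw [← Real.norm_eq_abs]
        refine ((F' (z - t • G) - F' z).le_opNorm G).trans ?_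
        refine mul_le_mul_of_nonneg_right ((hL _ _).trans (le_of_eq ?_)) (norm_nonneg _)
        rw [sub_sub_cancel_left, norm_neg, norm_smul, Real.norm_eq_abs, abs_of_pos ht.1]
      have h2 : L * (t * ‖G‖) * ‖G‖ ≤ 1 / 2 * Q := by
        have : L * t ≤ 1 / 2 := by nlinarith [ht.2]
        calc L * (t * ‖G‖) * ‖G‖ = L * t * ‖G‖ ^ 2 := by ring
          _ ≤ _ := by gcongr
      have h3 := (abs_le.1 (h1.trans h2)).1
      rw [sub_apply, hQ] at h3
      linarith) 0 ⟨le_rfl, hε⟩ ε ⟨hε, le_rfl⟩ hε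
  simp only [zero_smul, sub_zero] at this
  linarith

/-- A hyperbolic quadratic form perturbed by a periodic function with bounded Lipschitz
derivative has a critical point. -/
theorem exists_fderiv_eq_hyperbolic {A : Type*} [NormedAddCommGroup A]
    [InnerProductSpace ℝ A] [FiniteDimensional ℝ A] {W : ℝ × A × A → ℝ} (hW : ContDiff ℝ 2 W)
    {C K ℓ : ℝ} (hC : ∀ z, ‖fderiv ℝ W z‖ ≤ C)
    (hK : ∀ z w, ‖fderiv ℝ W z - fderiv ℝ W w‖ ≤ K * ‖z - w‖) (hK0 : 0 ≤ K) (hℓ : 0 < ℓ)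
    (hper : ∀ s a, W (s + ℓ, a) = W (s, a)) :
    ∃ z : ℝ × A × A, ∀ σ α β, fderiv ℝ W z (σ, α, β) = 2 * ⟪z.2.1, α⟫ - 2 * ⟪z.2.2, β⟫ := by
  have : CompleteSpace A := FiniteDimensional.complete ℝ A
  have hC0 : 0 ≤ C := (norm_nonneg (fderiv ℝ W 0)).trans (hC 0)
  have hdW : Differentiable ℝ W := hW.differentiable two_ne_zero
  let D := fderiv ℝ W
  have hD1 : ContDiff ℝ 1 D := hW.fderiv_right (by norm_num)
  let i₂ : A →L[ℝ] ℝ × A × A := (ContinuousLinearMap.inr ℝ ℝ (A × A)).comp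
    (ContinuousLinearMap.inl ℝ A A)
  let i₃ : A →L[ℝ] ℝ × A × A := (ContinuousLinearMap.inr ℝ ℝ (A × A)).comp
    (ContinuousLinearMap.inr ℝ A A)
  let R := (InnerProductSpace.toDual ℝ A).symm
  let g₁ : ℝ × A × A → ℝ := fun z => D z (1, 0, 0)
  let g₂ : ℝ × A × A → A := fun z => R ((D z).comp i₂)
  let g₃ : ℝ × A × A → A := fun z => R ((D z).comp i₃)
  have hR : ContDiff ℝ 1 R := R.toContinuousLinearEquiv.contDiff
  have hg₁ : ContDiff ℝ 1 g₁ := hD1.clm_apply contDiff_const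
  have hg₂ : ContDiff ℝ 1 g₂ := hR.comp (hD1.clm_comp contDiff_const)
  have hg₃ : ContDiff ℝ 1 g₃ := hR.comp (hD1.clm_comp contDiff_const)
  have hi₂ : ‖i₂‖ ≤ 1 := ContinuousLinearMap.opNorm_le_bound _ zero_le_one fun a => by
    simp [i₂, Prod.norm_def]
  have hi₃ : ‖i₃‖ ≤ 1 := ContinuousLinearMap.opNorm_le_bound _ zero_le_one fun a => by
    simp [i₃, Prod.norm_def]
  have hb₂ : ∀ z, ‖g₂ z‖ ≤ C := fun z => by
    simp only [g₂, LinearIsometryEquiv.norm_map]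
    refine ((D z).opNorm_comp_le i₂).trans ?_
    exact (mul_le_of_le_one_right (norm_nonneg _) hi₂).trans (hC z)
  have hb₃ : ∀ z, ‖g₃ z‖ ≤ C := fun z => by
    simp only [g₃, LinearIsometryEquiv.norm_map]
    refine ((D z).opNorm_comp_le i₃).trans ?_
    exact (mul_le_of_le_one_right (norm_nonneg _) hi₃).trans (hC z)
  have hD : ∀ z σ α β, D z (σ, α, β) = g₁ z * σ + ⟪g₂ z, α⟫ + ⟪g₃ z, β⟫ := by
    intro z σ α β
    have : (σ, α, β) = σ • ((1 : ℝ), (0 : A), (0 : A)) + i₂ α + i₃ β := by simp [i₂, i₃]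
    rw [this, map_add, map_add, map_smul]
    simp [g₁, g₂, g₃, R, InnerProductSpace.toDual_symm_apply, mul_comm]
  let G : ℝ × A × A → ℝ × A × A := fun z =>
    (-g₁ z, (2 : ℝ) • z.2.1 - g₂ z, -((2 : ℝ) • z.2.2) - g₃ z)
  let Q : ℝ × A × A → ℝ := fun z => (G z).1 ^ 2 + ‖(G z).2.1‖ ^ 2 + ‖(G z).2.2‖ ^ 2
  by_contra! hcon
  have hQpos : ∀ z, 0 < Q z := by
    intro z
    by_contra! hQ
    obtain ⟨σ, α, β, hne⟩ := hcon z
    have h1 : (G z).1 = 0 := by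
      have := sq_nonneg ‖(G z).2.1‖; have := sq_nonneg ‖(G z).2.2‖
      simp only [Q] at hQ
      nlinarith
    have h2 : (G z).2.1 = 0 := by
      have := sq_nonneg (G z).1; have := sq_nonneg ‖(G z).2.2‖
      simp only [Q] at hQ
      rw [← norm_eq_zero]
      nlinarith
    have h3 : (G z).2.2 = 0 := by
      have := sq_nonneg (G z).1; have := sq_nonneg ‖(G z).2.1‖
      simp only [Q] at hQ
      rw [← norm_eq_zero]
      nlinarith
    simp only [G] at h1 h2 h3
    apply hne
    rw [show fderiv ℝ W z = D z from rfl, hD, ← sub_eq_zero.1 h2, neg_eq_zero.1 h1,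
      ← sub_eq_zero.1 h3, inner_neg_left, inner_smul_left, inner_smul_left]
    simp
    ring
  have hGc : Continuous G := by
    have := hg₁.continuous; have := hg₂.continuous; have := hg₃.continuous
    fun_prop
  have hQc : Continuous Q := by fun_prop
  have hDper : ∀ s a, D (s + ℓ, a) = D (s, a) := by
    intro s a
    have h1 : (fun z => W (z + (ℓ, 0))) = W := by
      funext z
      obtain ⟨s, a⟩ := z
      simpa using hper s a
    have := fderiv_comp_add_right (𝕜 := ℝ) (f := W) (x := (s, a)) (ℓ, 0)
    rw [h1] at this
    simpa using this.symm
  have hQper : ∀ a, Function.Periodic (fun s => Q (s, a)) ℓ := by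
    intro a s
    simp only [Q, G, g₁, g₂, g₃, hDper]
  obtain ⟨δ, hδ, hQδ⟩ : ∃ δ > 0, ∀ z, δ ≤ Q z := by
    have hcomp : IsCompact (Icc 0 ℓ ×ˢ (Metric.closedBall (0 : A) (C + 1) ×ˢ
        Metric.closedBall (0 : A) (C + 1))) :=
      isCompact_Icc.prod ((isCompact_closedBall _ _).prod (isCompact_closedBall _ _))
    obtain ⟨z₀, -, hz₀⟩ := hcomp.exists_isMinOn ⟨(0, 0, 0), by simp [hℓ.le]; linarith⟩
      hQc.continuousOn
    refine ⟨min 1 (Q z₀), lt_min one_pos (hQpos _), ?_⟩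
    rintro ⟨s, u, v⟩
    by_cases hu : ‖u‖ ≤ C + 1
    · by_cases hv : ‖v‖ ≤ C + 1
      · obtain ⟨s', hs', he⟩ := (hQper (u, v)).exists_mem_Ico₀ hℓ s
        rw [show Q (s, u, v) = Q (s', u, v) from he]
        exact (min_le_right _ _).trans (hz₀ ⟨⟨hs'.1, hs'.2.le⟩, by simpa using ⟨hu, hv⟩⟩)
      · refine (min_le_left _ _).trans ?_
        have h1 : 1 ≤ ‖(G (s, u, v)).2.2‖ := by
          have := norm_sub_norm_le (-((2 : ℝ) • v)) (g₃ (s, u, v))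
          rw [norm_neg, norm_smul, Real.norm_ofNat] at this
          simp only [G]
          linarith [hb₃ (s, u, v)]
        simp only [Q]
        nlinarith [sq_nonneg (G (s, u, v)).1, sq_nonneg ‖(G (s, u, v)).2.1‖]
    · refine (min_le_left _ _).trans ?_
      have h1 : 1 ≤ ‖(G (s, u, v)).2.1‖ := by
        have := norm_sub_norm_le ((2 : ℝ) • u) (g₂ (s, u, v))
        rw [norm_smul, Real.norm_ofNat] at this
        simp only [G]
        linarith [hb₂ (s, u, v)]
      simp only [Q]
      nlinarith [sq_nonneg (G (s, u, v)).1, sq_nonneg ‖(G (s, u, v)).2.2‖]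
  let F : ℝ × A × A → ℝ := fun z => ‖z.2.1‖ ^ 2 - ‖z.2.2‖ ^ 2 - W z
  let p₂ : ℝ × A × A →L[ℝ] A := (ContinuousLinearMap.fst ℝ A A).comp
    (ContinuousLinearMap.snd ℝ ℝ (A × A))
  let p₃ : ℝ × A × A →L[ℝ] A := (ContinuousLinearMap.snd ℝ A A).comp
    (ContinuousLinearMap.snd ℝ ℝ (A × A))
  let F' : ℝ × A × A → (ℝ × A × A →L[ℝ] ℝ) := fun z =>
    (2 : ℝ) • (innerSL ℝ z.2.1).comp p₂ - (2 : ℝ) • (innerSL ℝ z.2.2).comp p₃ - D z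
  have hF : ∀ z, HasFDerivAt F (F' z) z := by
    intro z
    have h2 : HasFDerivAt (fun z : ℝ × A × A => ‖z.2.1‖ ^ 2)
        ((2 : ℝ) • (innerSL ℝ z.2.1).comp p₂) z := by
      have := (p₂.hasFDerivAt (x := z)).norm_sq
      simp only [two_smul] at this ⊢
      exact this
    have h3 : HasFDerivAt (fun z : ℝ × A × A => ‖z.2.2‖ ^ 2)
        ((2 : ℝ) • (innerSL ℝ z.2.2).comp p₃) z := by
      have := (p₃.hasFDerivAt (x := z)).norm_sq
      simp only [two_smul] at this ⊢
      exact this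
    exact (h2.sub h3).sub (hdW z).hasFDerivAt
  have hL : ∀ z w, ‖F' z - F' w‖ ≤ (4 + K) * ‖z - w‖ := by
    intro z w
    refine ContinuousLinearMap.opNorm_le_bound _ (by positivity) fun a => ?_
    have e : (F' z - F' w) a = 2 * ⟪(z - w).2.1, a.2.1⟫ - 2 * ⟪(z - w).2.2, a.2.2⟫
        - (D z - D w) a := by
      simp [F', p₂, p₃, inner_sub_left]; ring
    rw [e]
    have n1 : ∀ a : ℝ × A × A, ‖a.2.1‖ ≤ ‖a‖ := fun a => (norm_fst_le a.2).trans (norm_snd_le a)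
    have n2 : ∀ a : ℝ × A × A, ‖a.2.2‖ ≤ ‖a‖ := fun a => (norm_snd_le a.2).trans (norm_snd_le a)
    have e1 : |⟪(z - w).2.1, a.2.1⟫| ≤ ‖z - w‖ * ‖a‖ := (abs_real_inner_le_norm _ _).trans
      (mul_le_mul (n1 _) (n1 _) (norm_nonneg _) (norm_nonneg _))
    have e2 : |⟪(z - w).2.2, a.2.2⟫| ≤ ‖z - w‖ * ‖a‖ := (abs_real_inner_le_norm _ _).trans
      (mul_le_mul (n2 _) (n2 _) (norm_nonneg _) (norm_nonneg _))
    have e3 : |(D z - D w) a| ≤ K * ‖z - w‖ * ‖a‖ := by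
      rw [← Real.norm_eq_abs]
      exact ((D z - D w).le_opNorm a).trans (mul_le_mul_of_nonneg_right (hK z w) (norm_nonneg _))
    rw [Real.norm_eq_abs, abs_le]
    rw [abs_le] at e1 e2 e3
    constructor <;> linarith
  set ε : ℝ := 1 / (2 * (4 + K)) with hε
  have hε0 : 0 < ε := by positivity
  have hεL : ε * (4 + K) ≤ 1 / 2 := by rw [hε]; field_simp; rfl
  let T : ℝ × A × A → ℝ × A × A := fun z => z - ε • G z
  have hTF : ∀ z, F (T z) ≤ F z - ε / 2 * δ := by
    intro z
    have hFG : F' z (G z) = Q z := by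
      have h1 : F' z (G z) = 2 * ⟪z.2.1, (G z).2.1⟫ - 2 * ⟪z.2.2, (G z).2.2⟫ -
        D z ((G z).1, (G z).2.1, (G z).2.2) := by simp [F', p₂, p₃]
      rw [h1, hD]
      simp only [Q, ← real_inner_self_eq_norm_sq]
      have ha : ⟪(G z).2.1, (G z).2.1⟫ = 2 * ⟪z.2.1, (G z).2.1⟫ - ⟪g₂ z, (G z).2.1⟫ := by
        rw [← real_inner_smul_left, ← inner_sub_left]
      have hb : ⟪(G z).2.2, (G z).2.2⟫ = -(2 * ⟪z.2.2, (G z).2.2⟫) - ⟪g₃ z, (G z).2.2⟫ := by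
        rw [← real_inner_smul_left, ← inner_neg_left, ← inner_sub_left]
      have hc : (G z).1 ^ 2 = -g₁ z * (G z).1 := by rw [sq]
      rw [ha, hb, hc]
      ring
    have hGn : ‖G z‖ ^ 2 ≤ Q z := by
      have q1 := sq_nonneg (G z).1
      have q2 := sq_nonneg ‖(G z).2.1‖
      have q3 := sq_nonneg ‖(G z).2.2‖
      have : ‖G z‖ = ‖(G z).1‖ ∨ ‖G z‖ = ‖(G z).2.1‖ ∨ ‖G z‖ = ‖(G z).2.2‖ := by
        rw [Prod.norm_def, Prod.norm_def]
        rcases max_choice ‖(G z).1‖ (max ‖(G z).2.1‖ ‖(G z).2.2‖) with h | h <;>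
          rcases max_choice ‖(G z).2.1‖ ‖(G z).2.2‖ with h' | h' <;> rw [h] <;> try rw [h']
        all_goals simp
      simp only [Q]
      rcases this with h | h | h <;> rw [h]
      · rw [Real.norm_eq_abs, sq_abs]; linarith
      · linarith
      · linarith
    have := image_sub_smul_le_of_lipschitz_fderiv hF hL (by positivity) hε0.le hεL hFG hGn
    have := mul_le_mul_of_nonneg_left (hQδ z) (half_pos hε0).le
    simp only [T]
    linarith
  have hTM : ∀ M : ℕ, ∀ z, F (T^[M] z) ≤ F z - M * (ε / 2 * δ) := by
    intro M
    induction M with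
    | zero => intro z; simp
    | succ M ih =>
      intro z
      rw [Function.iterate_succ_apply']
      have := hTF (T^[M] z)
      have := ih z
      push_cast
      linarith
  have hTc : ContDiff ℝ 1 T := by
    have : ContDiff ℝ 1 G := by fun_prop
    fun_prop
  have hTv : ∀ M : ℕ, ∃ b : A → A, ContDiff ℝ 1 b ∧ (∃ B, ∀ v, ‖b v‖ ≤ B) ∧
      ∀ v, (T^[M] (0, 0, v)).2.2 = (1 + 2 * ε) ^ M • v + b v := by
    intro M
    induction M with
    | zero => exact ⟨fun _ => 0, contDiff_const, ⟨0, by simp⟩, by simp⟩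
    | succ M ih =>
      obtain ⟨b, hb, ⟨B, hB⟩, hv⟩ := ih
      refine ⟨fun v => (1 + 2 * ε) • b v + ε • g₃ (T^[M] (0, 0, v)), ?_,
        ⟨(1 + 2 * ε) * B + ε * C, fun v => ?_⟩, fun v => ?_⟩
      · have := contDiff_iterate hTc M
        fun_prop
      · refine (norm_add_le _ _).trans (add_le_add ?_ ?_)
        · rw [norm_smul, Real.norm_of_nonneg (by positivity)]
          gcongr
          exact hB v
        · rw [norm_smul, Real.norm_of_nonneg (by positivity)]
          gcongr
          exact hb₃ _
      · rw [Function.iterate_succ_apply']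
        have : ∀ z, (T z).2.2 = (1 + 2 * ε) • z.2.2 + ε • g₃ z := fun z => by
          simp only [T, G, Prod.snd_sub, Prod.smul_snd]
          module
        rw [this, hv, pow_succ]
        module
  have hWb : ∀ z w, |W z - W w| ≤ C * ‖z - w‖ := fun z w => by
    rw [← Real.norm_eq_abs]
    exact convex_univ.norm_image_sub_le_of_norm_fderiv_le (fun x _ => hdW x) (fun x _ => hC x)
      (mem_univ w) (mem_univ z)
  obtain ⟨M, hM⟩ := exists_nat_gt ((C * ℓ + 2 * C ^ 2) / (ε / 2 * δ))
  rw [div_lt_iff₀ (by positivity)] at hM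
  obtain ⟨b, hb, ⟨B, hB⟩, hv⟩ := hTv M
  obtain ⟨v, hv0⟩ := exists_add_eq_zero_of_bounded (b := fun v => ((1 + 2 * ε) ^ M)⁻¹ • b v)
    (hb.const_smul _) (C := ((1 + 2 * ε) ^ M)⁻¹ * B) fun v => by
      rw [norm_smul, Real.norm_of_nonneg (by positivity)]
      gcongr
      exact hB v
  have hzero : (T^[M] (0, 0, v)).2.2 = 0 := by
    have hne : (1 + 2 * ε) ^ M ≠ 0 := by positivity
    rw [hv, ← smul_right_injective A (inv_ne_zero hne) |>.eq_iff]
    simpa [smul_smul, hne] using hv0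
  have hfin := hTM M (0, 0, v)
  generalize T^[M] (0, 0, v) = z at hfin hzero
  obtain ⟨s, u, v'⟩ := z
  simp only at hzero
  subst hzero
  have hWper : Function.Periodic (fun s => W (s, u, 0)) ℓ := fun s => hper s _
  obtain ⟨s', hs', he⟩ := hWper.exists_mem_Ico₀ hℓ s
  simp only [F, he, norm_zero] at hfin
  have h1 := hWb (s', u, 0) (0, 0, 0)
  have h2 := hWb (0, 0, v) (0, 0, 0)
  have n1 : ‖((s', u, 0) : ℝ × A × A) - (0, 0, 0)‖ ≤ ℓ + ‖u‖ := by
    simp only [Prod.norm_def, Prod.fst_sub, Prod.snd_sub, sub_zero, norm_zero]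
    have : ‖s'‖ ≤ ℓ := by rw [Real.norm_of_nonneg hs'.1]; exact hs'.2.le
    have := norm_nonneg u
    refine max_le (by linarith) (max_le (by linarith) (by linarith))
  have n2 : ‖((0, 0, v) : ℝ × A × A) - (0, 0, 0)‖ ≤ ‖v‖ := by
    simp [Prod.norm_def]
  have h1' := (abs_le.1 (h1.trans (mul_le_mul_of_nonneg_left n1 hC0))).2
  have h2' := (abs_le.1 (h2.trans (mul_le_mul_of_nonneg_left n2 hC0))).1
  nlinarith [sq_nonneg (‖u‖ - C), sq_nonneg (‖v‖ - C), sq_nonneg (‖u‖ ), sq_nonneg ‖v‖,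
    sq_nonneg (2 * ‖u‖ - C), sq_nonneg (2 * ‖v‖ - C)]

/-- The canonical symplectic form on `V × V`. -/
noncomputable def canonicalForm {V : Type*} [NormedAddCommGroup V] [InnerProductSpace ℝ V]
    (a b : V × V) : ℝ := ⟪a.1, b.2⟫ - ⟪a.2, b.1⟫

/-- A smooth self-map of `V × V` preserving the canonical symplectic form. -/
def IsCanonicalMap {V : Type*} [NormedAddCommGroup V] [InnerProductSpace ℝ V]
    (θ : V × V → V × V) : Prop :=
  ContDiff ℝ ∞ θ ∧ ∀ z a b, canonicalForm (fderiv ℝ θ z a) (fderiv ℝ θ z b) = canonicalForm a b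

/-- A compactly supported canonical map that is `C¹`-close to the identity has a compactly
supported generating function. -/
theorem IsCanonicalMap.exists_generating_function {V : Type*} [NormedAddCommGroup V]
    [InnerProductSpace ℝ V] [FiniteDimensional ℝ V] [Nontrivial V] {θ : V × V → V × V}
    (hθ : IsCanonicalMap θ) {ρ : ℝ} (hout : ∀ z, ρ < ‖z‖ → θ z = z)
    (hclose : ∀ z, ‖fderiv ℝ θ z - ContinuousLinearMap.id ℝ (V × V)‖ ≤ 1 / 2) :
    Function.Bijective θ ∧ (∀ x P, ∃ p, (θ (x, p)).2 = P) ∧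
    ∃ S : V × V → ℝ, ContDiff ℝ ∞ S ∧ (∀ w, ρ < ‖w‖ → S w = 0) ∧
      ∀ z a b, fderiv ℝ S (z.1, (θ z).2) (a, b) = ⟪z.2 - (θ z).2, a⟫ + ⟪(θ z).1 - z.1, b⟫ := by
  have hne : (∞ : WithTop ℕ∞) ≠ 0 := by simp
  obtain ⟨e₀, he₀, -⟩ := exists_homeomorph_of_norm_fderiv_sub_id_le hne hθ.1 hclose
  have hθd : Differentiable ℝ θ := hθ.1.differentiable hne
  have hθs := hθ.1
  let κ : V × V → V × V := fun z => (z.1, (θ z).2)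
  have hκ : ContDiff ℝ ∞ κ := by fun_prop
  have hκd : ∀ z, HasFDerivAt κ ((ContinuousLinearMap.fst ℝ V V).prod
      ((ContinuousLinearMap.snd ℝ V V).comp (fderiv ℝ θ z))) z := fun z =>
    hasFDerivAt_fst.prodMk ((hθd z).hasFDerivAt.snd)
  obtain ⟨e, he, hes⟩ := exists_homeomorph_of_norm_fderiv_sub_id_le hne hκ fun z => by
    refine le_trans ?_ (hclose z)
    refine ContinuousLinearMap.opNorm_le_bound _ (by positivity) fun a => ?_
    refine le_trans ?_ ((fderiv ℝ θ z - ContinuousLinearMap.id ℝ (V × V)).le_opNorm a)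
    rw [(hκd z).fderiv]
    refine le_trans (le_of_eq ?_) (norm_snd_le _)
    simp [Prod.norm_def]
  have hκe : ∀ z, e z = κ z := fun z => by rw [he]
  refine ⟨he₀ ▸ e₀.bijective, fun x P => ?_, ?_⟩
  · obtain ⟨⟨x', p⟩, hz⟩ := e.surjective (x, P)
    rw [hκe] at hz
    simp only [κ, Prod.mk.injEq] at hz
    exact ⟨p, hz.1 ▸ hz.2⟩
  let β : V × V → V × V → ℝ := fun z d => ⟪z.2 - (θ z).2, d.1⟫ + ⟪(θ z).1 - z.1, d.2⟫
  let α : V × V → V × V →L[ℝ] ℝ := fun w =>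
    (innerSL ℝ ((e.symm w).2 - (θ (e.symm w)).2)).comp (ContinuousLinearMap.fst ℝ V V) +
    (innerSL ℝ ((θ (e.symm w)).1 - (e.symm w).1)).comp (ContinuousLinearMap.snd ℝ V V)
  have hαβ : ∀ w d, α w d = β (e.symm w) d := fun w d => by
    simp [α, β, inner_sub_left]
  have hα : ContDiff ℝ ∞ α := by
    have h1 : ContDiff ℝ ∞ fun w => θ (e.symm w) := hθs.comp hes
    have h2 : ContDiff ℝ ∞ fun v : V => innerSL ℝ v := (innerSL ℝ).contDiff
    refine ContDiff.add (ContDiff.clm_comp (h2.comp ?_) contDiff_const)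
      (ContDiff.clm_comp (h2.comp ?_) contDiff_const) <;> fun_prop
  have hαd : Differentiable ℝ α := hα.differentiable hne
  have hDα : ∀ z ζ d, fderiv ℝ α (κ z) (fderiv ℝ κ z ζ) d =
      ⟪ζ.2 - (fderiv ℝ θ z ζ).2, d.1⟫ + ⟪(fderiv ℝ θ z ζ).1 - ζ.1, d.2⟫ := by
    intro z ζ d
    have h0 := HasFDerivAt.comp (g := α) z (hαd (κ z)).hasFDerivAt (hκd z)
    have h1 := h0.clm_apply (hasFDerivAt_const d z)
    have h2 : (fun z => (α ∘ κ) z d) = fun z => β z d := by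
      funext z
      rw [Function.comp_apply, hαβ, ← hκe, e.symm_apply_apply]
    have h3 : HasFDerivAt (fun z => β z d) ((innerSL ℝ d.1).comp
        (ContinuousLinearMap.snd ℝ V V - (ContinuousLinearMap.snd ℝ V V).comp (fderiv ℝ θ z)) +
        (innerSL ℝ d.2).comp ((ContinuousLinearMap.fst ℝ V V).comp (fderiv ℝ θ z) -
          ContinuousLinearMap.fst ℝ V V)) z := by
      simp only [β]
      simp_rw [real_inner_comm d.1, real_inner_comm d.2]
      exact ((innerSL ℝ d.1).hasFDerivAt.comp z
        (hasFDerivAt_snd.sub (hθd z).hasFDerivAt.snd)).add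
        ((innerSL ℝ d.2).hasFDerivAt.comp z ((hθd z).hasFDerivAt.fst.sub hasFDerivAt_fst))
    rw [h2] at h1
    have := congrArg (fun L => L ζ) (h1.unique h3)
    simp only [(hκd z).fderiv]
    rw [real_inner_comm d.1, real_inner_comm d.2]
    simpa [inner_sub_right] using this
  have hsym : ∀ w c d, fderiv ℝ α w c d = fderiv ℝ α w d c := by
    intro w c d
    obtain ⟨z, rfl⟩ : ∃ z, κ z = w := by rw [← he]; exact e.surjective w
    have hsurj : ∀ c, ∃ ζ, fderiv ℝ κ z ζ = c := fun c => by
      refine ⟨fderiv ℝ e.symm (κ z) c, ?_⟩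
      have h1 : HasFDerivAt (κ ∘ e.symm) _ (κ z) := HasFDerivAt.comp (κ z)
        (by rw [← hκe, e.symm_apply_apply]; exact (hκd z))
        ((hes.differentiable hne) (κ z)).hasFDerivAt
      have h2 : κ ∘ e.symm = id := by funext w; simp [← he]
      rw [h2] at h1
      rw [(hκd z).fderiv]
      have := congrArg (fun L => L c) (h1.unique (hasFDerivAt_id _))
      simpa using this
    obtain ⟨ζ, rfl⟩ := hsurj c
    obtain ⟨η, rfl⟩ := hsurj d
    rw [hDα, hDα]
    have := hθ.2 z ζ η
    simp only [(hκd z).fderiv, canonicalForm] at this ⊢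
    simp only [ContinuousLinearMap.prod_apply, ContinuousLinearMap.comp_apply,
      ContinuousLinearMap.coe_fst', ContinuousLinearMap.coe_snd', inner_sub_left]
    have := real_inner_comm (fderiv ℝ θ z η).2 ζ.1
    have := real_inner_comm (fderiv ℝ θ z ζ).2 η.1
    have := real_inner_comm (fderiv ℝ θ z ζ).2 (fderiv ℝ θ z η).1
    have := real_inner_comm η.2 ζ.1
    linarith
  obtain ⟨S, hS⟩ : ∃ S : V × V → ℝ, ∀ w, HasFDerivAt S (α w) w := by
    obtain ⟨S, hS⟩ := convex_univ.exists_forall_hasFDerivAt_of_fderiv_symmetric isOpen_univ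
      hαd.differentiableOn fun w _ => hsym w
    exact ⟨S, fun w => hS w (mem_univ w)⟩
  have hαz : ∀ w, ρ < ‖w‖ → α w = 0 := by
    intro w hw
    have : e.symm w = w := by
      rw [e.symm_apply_eq, hκe]
      simp [κ, hout w hw]
    ext d <;> simp [α, this, hout w hw]
  have hSd : Differentiable ℝ S := fun w => (hS w).differentiableAt
  obtain ⟨v₀, hv₀⟩ := NormedSpace.exists_lt_norm ℝ V ρ
  have hfst : ∀ P, ρ < ‖P‖ → ∀ x x', S (x, P) = S (x', P) := by
    intro P hP x x'
    refine is_const_of_fderiv_eq_zero (𝕜 := ℝ) (f := fun x => S (x, P)) (by fun_prop) (fun x => ?_) x x'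
    have : HasFDerivAt (fun x => S (x, P)) _ x :=
      (hS (x, P)).comp x (hasFDerivAt_prodMk_left x P)
    rw [hαz _ (hP.trans_le (norm_snd_le (x, P)))] at this
    simpa using this.fderiv
  have hsnd : ∀ x, ρ < ‖x‖ → ∀ P P', S (x, P) = S (x, P') := by
    intro x hx P P'
    refine is_const_of_fderiv_eq_zero (𝕜 := ℝ) (f := fun P => S (x, P)) (by fun_prop) (fun P => ?_) P P'
    have : HasFDerivAt (fun P => S (x, P)) _ P :=
      (hS (x, P)).comp P (hasFDerivAt_prodMk_right x P)
    rw [hαz _ (hx.trans_le (norm_fst_le (x, P)))] at this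
    simpa using this.fderiv
  refine ⟨fun w => S w - S (0, v₀), ?_, ?_, ?_⟩
  · refine ContDiff.sub ?_ contDiff_const
    rw [contDiff_infty_iff_fderiv]
    refine ⟨hSd, ?_⟩
    rwa [show fderiv ℝ S = α from funext fun w => (hS w).fderiv]
  · rintro ⟨x, P⟩ hw
    rw [sub_eq_zero]
    rcases lt_max_iff.1 (Prod.norm_def (x, P) ▸ hw) with h | h
    · rw [hsnd x h P v₀, hfst v₀ hv₀ x 0]
    · rw [hfst P h x v₀, hsnd v₀ hv₀ P v₀, hfst v₀ hv₀ v₀ 0]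
  · intro z a b
    rw [fderiv_sub_const, show (z.1, (θ z).2) = κ z from rfl, (hS _).fderiv, hαβ, ← hκe,
      e.symm_apply_apply]

section

/-- Twice continuously differentiable with bounded Lipschitz derivative. -/
def HasBoundedLipschitzFDeriv {E : Type*} [NormedAddCommGroup E] [NormedSpace ℝ E]
    (f : E → ℝ) : Prop :=
  ContDiff ℝ 2 f ∧ ∃ C K : ℝ, 0 ≤ K ∧ (∀ z, ‖fderiv ℝ f z‖ ≤ C) ∧
    ∀ z w, ‖fderiv ℝ f z - fderiv ℝ f w‖ ≤ K * ‖z - w‖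

namespace HasBoundedLipschitzFDeriv

variable {E : Type*} [NormedAddCommGroup E] [NormedSpace ℝ E]

theorem of_bounded {f : E → ℝ} (hf : ContDiff ℝ 2 f) {C K : ℝ} (hC : ∀ z, ‖fderiv ℝ f z‖ ≤ C)
    (hK : ∀ z, ‖fderiv ℝ (fderiv ℝ f) z‖ ≤ K) : HasBoundedLipschitzFDeriv f :=
  ⟨hf, C, K, (norm_nonneg (fderiv ℝ (fderiv ℝ f) 0)).trans (hK 0), hC, fun z w =>
    convex_univ.norm_image_sub_le_of_norm_fderiv_le
      (fun x _ => (hf.fderiv_right (m := 1) (by norm_num)).differentiable one_ne_zero x)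
      (fun x _ => hK x) (mem_univ w) (mem_univ z)⟩

theorem add {f g : E → ℝ} (hf : HasBoundedLipschitzFDeriv f) (hg : HasBoundedLipschitzFDeriv g) :
    HasBoundedLipschitzFDeriv (fun z => f z + g z) := by
  obtain ⟨hf, C, K, hK0, hC, hK⟩ := hf
  obtain ⟨hg, C', K', hK0', hC', hK'⟩ := hg
  have hd : ∀ z, fderiv ℝ (fun z => f z + g z) z = fderiv ℝ f z + fderiv ℝ g z := fun z =>
    fderiv_fun_add (hf.differentiable two_ne_zero z) (hg.differentiable two_ne_zero z)
  refine ⟨hf.add hg, C + C', K + K', by positivity, fun z => ?_, fun z w => ?_⟩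
  · rw [hd]
    exact (norm_add_le _ _).trans (add_le_add (hC z) (hC' z))
  · rw [hd, hd, add_sub_add_comm, add_mul]
    exact (norm_add_le _ _).trans (add_le_add (hK z w) (hK' z w))

theorem sum {ι : Type*} (s : Finset ι) {f : ι → E → ℝ}
    (hf : ∀ i, HasBoundedLipschitzFDeriv (f i)) :
    HasBoundedLipschitzFDeriv (fun z => ∑ i ∈ s, f i z) := by
  classical
  induction s using Finset.induction_on with
  | empty => exact ⟨by simpa using contDiff_const, 0, 0, le_rfl, by simp, by simp⟩
  | insert i s hi ih =>
    simp_rw [Finset.sum_insert hi]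
    exact (hf i).add ih

theorem comp_clm {F : Type*} [NormedAddCommGroup F] [NormedSpace ℝ F] {f : F → ℝ}
    (hf : HasBoundedLipschitzFDeriv f) (L : E →L[ℝ] F) :
    HasBoundedLipschitzFDeriv (fun z => f (L z)) := by
  obtain ⟨hf, C, K, hK0, hC, hK⟩ := hf
  have hd : ∀ z, fderiv ℝ (fun z => f (L z)) z = (fderiv ℝ f (L z)).comp L := fun z =>
    ((hf.differentiable two_ne_zero (L z)).hasFDerivAt.comp z L.hasFDerivAt).fderiv
  refine ⟨hf.comp L.contDiff, C * ‖L‖, K * ‖L‖ * ‖L‖, by positivity, fun z => ?_, fun z w => ?_⟩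
  · rw [hd]
    exact (ContinuousLinearMap.opNorm_comp_le _ _).trans (by gcongr; exact hC _)
  · rw [hd, hd, ← ContinuousLinearMap.sub_comp]
    refine (ContinuousLinearMap.opNorm_comp_le _ _).trans ?_
    calc _ ≤ (K * (‖L‖ * ‖z - w‖)) * ‖L‖ := by
          gcongr
          refine (hK _ _).trans ?_
          gcongr
          rw [← map_sub]
          exact L.le_opNorm _
      _ = _ := by ring

end HasBoundedLipschitzFDeriv

theorem HasCompactSupport.exists_bound_fderiv {E F : Type*} [NormedAddCommGroup E]
    [NormedSpace ℝ E] [NormedAddCommGroup F] [NormedSpace ℝ F] {S : E → F}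
    (hsupp : HasCompactSupport S) (hS : ContDiff ℝ 1 S) :
    ∃ C : ℝ, ∀ z, ‖fderiv ℝ S z‖ ≤ C :=
  (hsupp.fderiv ℝ).exists_bound_of_continuous (hS.continuous_fderiv one_ne_zero)

theorem HasCompactSupport.exists_bound_fderiv_fderiv {E : Type*} [NormedAddCommGroup E]
    [NormedSpace ℝ E] {S : E → ℝ} (hsupp : HasCompactSupport S) (hS : ContDiff ℝ 2 S) :
    ∃ C : ℝ, ∀ z, ‖fderiv ℝ (fderiv ℝ S) z‖ ≤ C := by
  have hS1 : ContDiff ℝ 1 (fderiv ℝ S) := hS.fderiv_right (by norm_num)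
  exact (hsupp.fderiv ℝ).exists_bound_fderiv hS1

theorem fderiv_fderiv_comp_sub {E : Type*} [NormedAddCommGroup E] [NormedSpace ℝ E] (S : E → ℝ)
    (c w : E) : fderiv ℝ (fderiv ℝ fun z => S (z - c)) w = fderiv ℝ (fderiv ℝ S) (w - c) := by
  have h : fderiv ℝ (fun z => S (z - c)) = fun z => fderiv ℝ S (z - c) :=
    funext fun z => fderiv_comp_sub c
  rw [h, fderiv_comp_sub]

/-- Periodization of a compactly supported function in the direction of a unit vector. -/
theorem exists_periodization {V : Type*} [NormedAddCommGroup V]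
    [InnerProductSpace ℝ V] [FiniteDimensional ℝ V] {S : V × V → ℝ} (hS : ContDiff ℝ ∞ S)
    {ρ ℓ : ℝ} (hρ : 0 < ρ) (hℓ : 4 * ρ ≤ ℓ) (hout : ∀ w, ρ < ‖w‖ → S w = 0) {u : V}
    (hu : ‖u‖ = 1) :
    ∃ T : V × V → ℝ, HasBoundedLipschitzFDeriv T ∧ (∀ x P, T (x + ℓ • u, P) = T (x, P)) ∧
      ∀ x P, |⟪x, u⟫| ≤ ℓ / 2 → fderiv ℝ T (x, P) = fderiv ℝ S (x, P) := by
  have hℓ0 : 0 < ℓ := by linarith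
  have huu : ⟪u, u⟫ = 1 := by rw [real_inner_self_eq_norm_sq, hu]; norm_num
  have hS0 : ∀ x P, ρ < |⟪x, u⟫| → S (x, P) = 0 := fun x P h => hout _ <| by
    refine h.trans_le ((abs_real_inner_le_norm _ _).trans ?_)
    rw [hu, mul_one]
    exact norm_fst_le (x, P)
  let r : V → ℤ := fun x => round (⟪x, u⟫ / ℓ)
  let T : V × V → ℝ := fun w => S (w.1 - (r w.1 * ℓ) • u, w.2)
  have hr : ∀ x, |⟪x, u⟫ - r x * ℓ| ≤ ℓ / 2 := fun x => by
    have h := abs_sub_round (⟪x, u⟫ / ℓ)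
    have : ⟪x, u⟫ - r x * ℓ = (⟪x, u⟫ / ℓ - r x) * ℓ := by field_simp
    rw [this, abs_mul, abs_of_pos hℓ0]
    nlinarith
  have hloc : ∀ (j : ℤ) x P, |⟪x, u⟫ - j * ℓ| < 3 * ℓ / 4 →
      T (x, P) = S (x - (j * ℓ) • u, P) := by
    intro j x P h
    by_cases hj : r x = j
    · simp only [T, hj]
    · have h1 : (1 : ℝ) ≤ |((r x - j : ℤ) : ℝ)| := by
        rw [← Int.cast_abs]
        exact_mod_cast Int.one_le_abs (sub_ne_zero.2 hj)
      have h2 : ℓ ≤ |⟪x, u⟫ - j * ℓ| + |⟪x, u⟫ - r x * ℓ| := by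
        calc ℓ ≤ |((r x - j : ℤ) : ℝ)| * ℓ := by nlinarith
          _ = |(⟪x, u⟫ - j * ℓ) - (⟪x, u⟫ - r x * ℓ)| := by
            rw [← abs_of_pos hℓ0, ← abs_mul, abs_of_pos hℓ0]
            push_cast
            congr 1
            ring
          _ ≤ _ := abs_sub _ _
      have h3 := hr x
      simp only [T]
      rw [hS0, hS0]
      · rw [inner_sub_left, inner_smul_left, huu]
        simp only [conj_trivial, mul_one]
        linarith
      · rw [inner_sub_left, inner_smul_left, huu]
        simp only [conj_trivial, mul_one]
        linarith
  have hev : ∀ (j : ℤ) w, |⟪w.1, u⟫ - j * ℓ| < 3 * ℓ / 4 →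
      T =ᶠ[𝓝 w] fun z => S (z - ((j * ℓ) • u, (0 : V))) := by
    intro j w hw
    have ho : IsOpen {z : V × V | |⟪z.1, u⟫ - j * ℓ| < 3 * ℓ / 4} :=
      isOpen_lt (by fun_prop) continuous_const
    filter_upwards [ho.mem_nhds hw] with z hz
    rw [show z = (z.1, z.2) from rfl, hloc j z.1 z.2 hz]
    rw [show z - ((j * ℓ) • u, (0 : V)) = (z.1 - (j * ℓ) • u, z.2) by ext <;> simp]
  have hr' : ∀ x, |⟪x, u⟫ - r x * ℓ| < 3 * ℓ / 4 := fun x => (hr x).trans_lt (by linarith)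
  have hTs : ContDiff ℝ ∞ T := contDiff_iff_contDiffAt.2 fun w =>
    ContDiffAt.congr_of_eventuallyEq (by fun_prop) (hev _ w (hr' w.1))
  have hfd : ∀ (j : ℤ) w, |⟪w.1, u⟫ - j * ℓ| < 3 * ℓ / 4 →
      fderiv ℝ T w = fderiv ℝ S (w - ((j * ℓ) • u, (0 : V))) := fun j w hw => by
    rw [(hev j w hw).fderiv_eq, fderiv_comp_sub]
  have hffd : ∀ (j : ℤ) w, |⟪w.1, u⟫ - j * ℓ| < 3 * ℓ / 4 →
      fderiv ℝ (fderiv ℝ T) w = fderiv ℝ (fderiv ℝ S) (w - ((j * ℓ) • u, (0 : V))) :=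
      fun j w hw => by
    rw [(hev j w hw).fderiv.fderiv_eq, fderiv_fderiv_comp_sub]
  have hsupp : HasCompactSupport S := HasCompactSupport.intro
    (isCompact_closedBall (0 : V × V) ρ) fun x hx => hout x (by simpa using hx)
  obtain ⟨C, hC⟩ := hsupp.exists_bound_fderiv (hS.of_le (by simp))
  obtain ⟨K, hK⟩ := hsupp.exists_bound_fderiv_fderiv (hS.of_le ENat.LEInfty.out)
  refine ⟨T, .of_bounded (C := C) (K := K) (hTs.of_le ENat.LEInfty.out) (fun w => ?_)
    (fun w => ?_), fun x P => ?_, fun x P h => ?_⟩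
  · rw [hfd _ w (hr' w.1)]
    exact hC _
  · rw [hffd _ w (hr' w.1)]
    exact hK _
  · rw [hloc (r x + 1) (x + ℓ • u) P]
    · simp only [T]
      congr 2
      push_cast
      module
    · rw [inner_add_left, inner_smul_left, huu]
      push_cast
      simp only [conj_trivial, mul_one]
      convert hr' x using 2
      ring
  · rw [hfd 0 (x, P) (by push_cast; rw [zero_mul, sub_zero]; exact h.trans_lt (by linarith))]
    simp

end

/-- An intersection theorem for iterates of canonical maps that are `C¹`-close to the identity:
the `N`-th iterate maps some point of a prescribed curve-type family into the zero section. -/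
theorem IsCanonicalMap.exists_iterate_snd_eq_zero {V : Type*} [NormedAddCommGroup V]
    [InnerProductSpace ℝ V] [FiniteDimensional ℝ V] {θ : V × V → V × V}
    (hθ : IsCanonicalMap θ) {ρ ℓ : ℝ} (hρ : 0 < ρ) (hℓ : 4 * ρ ≤ ℓ)
    (hout : ∀ z, ρ < ‖z‖ → θ z = z)
    (hclose : ∀ z, ‖fderiv ℝ θ z - ContinuousLinearMap.id ℝ (V × V)‖ ≤ 1 / 2)
    {u : V} (hu : ‖u‖ = 1) (N : ℕ) {g : ℝ → ℝ} (hg : HasBoundedLipschitzFDeriv g)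
    (hper : ∀ s, g (s + ℓ) = g s) :
    ∃ s p, |s| ≤ ℓ / 2 ∧ ⟪p, u⟫ = -fderiv ℝ g s 1 ∧ (θ^[N] (s • u, p)).2 = 0 := by
  have hℓ0 : 0 < ℓ := by linarith
  have : CompleteSpace V := FiniteDimensional.complete ℝ V
  have : Nontrivial V := ⟨⟨u, 0, fun h => by simp [h] at hu⟩⟩
  have huu : ⟪u, u⟫ = 1 := by rw [real_inner_self_eq_norm_sq, hu]; norm_num
  obtain ⟨hbij, hsurj, S, hS, hSout, hSθ⟩ := hθ.exists_generating_function hout hclose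
  obtain ⟨T, hT, hTper, hTS⟩ := exists_periodization hS hρ hℓ hSout hu
  let A := PiLp 2 (fun _ : Fin N => V)
  let pr : ℕ → A →L[ℝ] V := fun j =>
    if h : j < N then PiLp.proj 2 (fun _ : Fin N => V) ⟨j, h⟩ else 0
  have hpr : ∀ k (hk : k < N) (w : A), pr k w = w.ofLp ⟨k, hk⟩ := fun k hk w => by
    simp only [pr, hk, dite_true]
    rfl
  let p₁ : ℝ × A × A →L[ℝ] ℝ := ContinuousLinearMap.fst ℝ ℝ (A × A)
  let p₂ : ℝ × A × A →L[ℝ] A := (ContinuousLinearMap.fst ℝ A A).comp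
    (ContinuousLinearMap.snd ℝ ℝ (A × A))
  let p₃ : ℝ × A × A →L[ℝ] A := (ContinuousLinearMap.snd ℝ A A).comp
    (ContinuousLinearMap.snd ℝ ℝ (A × A))
  let L : ℕ → ℝ × A × A →L[ℝ] V × V := fun i =>
    (p₁.smulRight u + (∑ j ∈ Finset.range i, pr j).comp (p₂ + p₃)).prod ((pr i).comp (p₂ - p₃))
  have hL : ∀ i s a b, L i (s, a, b) =
      (s • u + ∑ j ∈ Finset.range i, pr j (a + b), pr i (a - b)) := fun i s a b => by
    simp [L, p₁, p₂, p₃, Finset.sum_add_distrib]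
  let W : ℝ × A × A → ℝ := fun z => (∑ i ∈ Finset.range N, T (L i z)) + g (p₁ z)
  have hW : HasBoundedLipschitzFDeriv W :=
    (HasBoundedLipschitzFDeriv.sum _ fun i => hT.comp_clm (L i)).add (hg.comp_clm p₁)
  have hWper : ∀ s a, W (s + ℓ, a) = W (s, a) := by
    rintro s ⟨a, b⟩
    simp only [W, hL, p₁, ContinuousLinearMap.coe_fst', hper]
    congr 1
    refine Finset.sum_congr rfl fun i _ => ?_
    rw [← hTper (s • u + _)]
    congr 2
    module
  obtain ⟨hW2, C, K, hK0, hC, hK⟩ := hW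
  obtain ⟨⟨s₀, a, b⟩, hcrit₀⟩ := exists_fderiv_eq_hyperbolic hW2 hC hK hK0 hℓ0 hWper
  obtain ⟨s, hs, hcrit⟩ : ∃ s, |s| ≤ ℓ / 2 ∧ ∀ σ α β, fderiv ℝ W (s, a, b) (σ, α, β) =
      2 * ⟪a, α⟫ - 2 * ⟪b, β⟫ := by
    have hD : Function.Periodic (fun s => fderiv ℝ W (s, a, b)) ℓ := by
      intro s
      have h1 : (fun z => W (z + (ℓ, 0))) = W := by
        funext ⟨s, a⟩
        simpa using hWper s a
      have := fderiv_comp_add_right (𝕜 := ℝ) (f := W) (x := (s, a, b)) (ℓ, 0)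
      rw [h1] at this
      simpa using this.symm
    obtain ⟨s, hs, he⟩ := hD.exists_mem_Ico hℓ0 s₀ (-(ℓ / 2))
    refine ⟨s, abs_le.2 ⟨hs.1, by linarith [hs.2]⟩, ?_⟩
    rwa [← show fderiv ℝ W (s₀, a, b) = fderiv ℝ W (s, a, b) from he]
  clear hcrit₀ s₀
  let y : A := a + b
  let P : A := a - b
  let X : ℕ → V := fun i => s • u + ∑ j ∈ Finset.range i, pr j y
  let D : ℕ → V × V →L[ℝ] ℝ := fun i => fderiv ℝ T (X i, pr i P)
  have hder : ∀ σ α β, ∑ i ∈ Finset.range N, D i (L i (σ, α, β)) + fderiv ℝ g s 1 * σ =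
      2 * ⟪a, α⟫ - 2 * ⟪b, β⟫ := by
    intro σ α β
    rw [← hcrit σ α β]
    have hTd := hT.1.differentiable two_ne_zero
    have hgd := hg.1.differentiable two_ne_zero
    have h1 : HasFDerivAt W (∑ i ∈ Finset.range N, (D i).comp (L i) + (fderiv ℝ g s).comp p₁)
        (s, a, b) := by
      refine HasFDerivAt.add (HasFDerivAt.fun_sum fun i _ => ?_) ?_
      · refine HasFDerivAt.comp (g := T) (s, a, b) ?_ (L i).hasFDerivAt
        rw [hL]
        exact (hTd _).hasFDerivAt
      · exact HasFDerivAt.comp (g := g) (s, a, b) (hgd s).hasFDerivAt p₁.hasFDerivAt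
    rw [h1.fderiv]
    have : fderiv ℝ g s σ = fderiv ℝ g s 1 * σ := by
      conv_lhs => rw [show σ = σ • (1 : ℝ) by simp, map_smul]
      rw [smul_eq_mul, mul_comm]
    simpa [p₁, sum_apply] using this.symm
  -- the critical point equations in the coordinates `y`, `P`
  have hcoord : ∀ η π : A, ∑ i ∈ Finset.range N,
      D i (∑ j ∈ Finset.range i, pr j η, pr i π) = ⟪P, η⟫ + ⟪y, π⟫ := by
    intro η π
    have := hder 0 ((1 / 2 : ℝ) • (η + π)) ((1 / 2 : ℝ) • (η - π))
    simp only [hL] at this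
    rw [← smul_add, ← smul_sub, show η + π + (η - π) = (2 : ℝ) • η by module,
      show η + π - (η - π) = (2 : ℝ) • π by module] at this
    simp only [smul_smul, one_div, inv_mul_cancel₀ (two_ne_zero' ℝ), one_smul, zero_smul, zero_add,
      mul_zero, add_zero] at this
    rw [this]
    simp only [inner_smul_right, inner_add_right, inner_sub_right, y, P, inner_add_left,
      inner_sub_left]
    ring
  have hsingle : ∀ k (hk : k < N) (v : V), ∃ η : A,
      (∀ j, pr j η = if j = k then v else 0) ∧ ∀ w : A, ⟪w, η⟫ = ⟪pr k w, v⟫ := by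
    intro k hk v
    refine ⟨PiLp.single 2 ⟨k, hk⟩ v, fun j => ?_, fun w => ?_⟩
    · by_cases hj : j < N
      · rw [hpr j hj]
        simp [PiLp.single_apply]
      · have : j ≠ k := fun h => hj (h ▸ hk)
        simp [pr, hj, this]
    · rw [PiLp.inner_apply, Finset.sum_eq_single ⟨k, hk⟩]
      · simp [hpr k hk]
      · intro i _ hi
        simp [hi]
      · simp
  have hy : ∀ k < N, ∀ v, D k (0, v) = ⟪pr k y, v⟫ := by
    intro k hk v
    obtain ⟨η, hη, hηi⟩ := hsingle k hk v
    have := hcoord 0 η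
    rw [inner_zero_right, zero_add, hηi] at this
    rw [← this, Finset.sum_eq_single_of_mem k (Finset.mem_range.2 hk)]
    · simp [hη]
    · intro i _ hi
      simp only [hη, hi, map_zero, Finset.sum_const_zero, if_false]
      exact (D i).map_zero.symm ▸ rfl
  have hP : ∀ k < N, ∀ v, ∑ i ∈ Finset.Ico (k + 1) N, D i (v, 0) = ⟪pr k P, v⟫ := by
    intro k hk v
    obtain ⟨η, hη, hηi⟩ := hsingle k hk v
    have := hcoord η 0
    rw [inner_zero_right, add_zero, hηi] at this
    rw [← this]
    refine Finset.sum_subset_zero_on_sdiff (fun i hi => ?_) (fun i hi => ?_) fun i hi => ?_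
    · exact Finset.mem_range.2 (Finset.mem_Ico.1 hi).2
    · simp only [Finset.mem_sdiff, Finset.mem_range, Finset.mem_Ico] at hi
      have : ∑ j ∈ Finset.range i, pr j η = 0 := Finset.sum_eq_zero fun j hj => by
        rw [hη, if_neg]
        have := Finset.mem_range.1 hj
        omega
      rw [this, map_zero]
      exact (D i).map_zero
    · have hki : k < i := (Finset.mem_Ico.1 hi).1
      simp [hη, hki]
  let Q : ℕ → V := fun i => (InnerProductSpace.toDual ℝ V).symm
    (∑ j ∈ Finset.Ico i N, (D j).comp (ContinuousLinearMap.inl ℝ V V))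
  have hQ : ∀ i v, ⟪Q i, v⟫ = ∑ j ∈ Finset.Ico i N, D j (v, 0) := fun i v => by
    rw [InnerProductSpace.toDual_symm_apply]
    simp [sum_apply]
  have hQP : ∀ k < N, Q (k + 1) = pr k P := fun k hk => by
    refine ext_inner_right ℝ fun v => ?_
    rw [hQ, hP k hk]
  have hmaps : ∀ z : V × V, |⟪z.1, u⟫| ≤ ℓ / 2 → |⟪(θ z).1, u⟫| ≤ ℓ / 2 := by
    intro z hz
    by_cases h : ρ < ‖z‖
    · rwa [hout z h]
    · have h1 : ‖θ z‖ ≤ ρ := by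
        by_contra! h2
        have h3 := hbij.1 (hout _ h2)
        rw [h3] at h2
        exact h h2
      refine (abs_real_inner_le_norm _ _).trans ?_
      rw [hu, mul_one]
      exact (norm_fst_le _).trans (h1.trans (by linarith))
  have hiter : ∀ i ≤ N, θ^[i] (s • u, Q 0) = (X i, Q i) ∧ |⟪X i, u⟫| ≤ ℓ / 2 := by
    intro i
    induction i with
    | zero =>
      intro _
      simp [X, inner_smul_left, hu, hs]
    | succ i ih =>
      intro hi
      obtain ⟨h1, h2⟩ := ih (by omega)
      obtain ⟨p, hp⟩ := hsurj (X i) (pr i P)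
      have hgen := hSθ (X i, p)
      simp only [hp] at hgen
      rw [← hTS _ _ h2] at hgen
      have hpQ : p = Q i := by
        refine ext_inner_right ℝ fun v => ?_
        have := hgen v 0
        rw [inner_zero_right, add_zero, inner_sub_left, ← hQP i (by omega), hQ] at this
        rw [hQ, Finset.sum_eq_sum_Ico_succ_bot (by omega)]
        simp only [D]
        rw [← hQP i (by omega), this]
        ring
      have hXy : (θ (X i, p)).1 = X (i + 1) := by
        refine ext_inner_right ℝ fun v => ?_
        have := hgen 0 v
        rw [inner_zero_right, zero_add, inner_sub_left] at this
        simp only [X, Finset.sum_range_succ, inner_add_left] at this ⊢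
        rw [← hy i (by omega)]
        simp only [D, X]
        linarith
      have hθX : θ (X i, Q i) = (X (i + 1), Q (i + 1)) := by
        rw [← hpQ]
        exact Prod.ext hXy (hp.trans (hQP i (by omega)).symm)
      rw [Function.iterate_succ_apply', h1, hθX]
      refine ⟨rfl, ?_⟩
      have := hmaps (X i, Q i) h2
      rwa [hθX] at this
  refine ⟨s, Q 0, hs, ?_, ?_⟩
  · have := hder 1 0 0
    simp only [hL, add_zero, map_zero, Finset.sum_const_zero, sub_zero, one_smul, mul_one,
      inner_zero_right, mul_zero] at this
    rw [hQ, Nat.Ico_zero_eq_range]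
    linarith
  · rw [(hiter N le_rfl).1]
    simp [Q]

section

variable {V : Type*} [NormedAddCommGroup V] [InnerProductSpace ℝ V]

lemma IsCanonicalMap.differentiable {θ : V × V → V × V} (hθ : IsCanonicalMap θ) :
    Differentiable ℝ θ := hθ.1.differentiable (by simp)

lemma IsCanonicalMap.comp {θ η : V × V → V × V} (hθ : IsCanonicalMap θ)
    (hη : IsCanonicalMap η) : IsCanonicalMap (θ ∘ η) := by
  refine ⟨hθ.1.comp hη.1, fun z a b => ?_⟩
  rw [fderiv_comp z (hθ.differentiable _) (hη.differentiable _)]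
  simp only [ContinuousLinearMap.comp_apply, hθ.2, hη.2]

lemma IsCanonicalMap.symm {e : V × V ≃ V × V} (he : IsCanonicalMap e)
    (hs : ContDiff ℝ ∞ e.symm) : IsCanonicalMap e.symm := by
  refine ⟨hs, fun z a b => ?_⟩
  have h : ∀ a, fderiv ℝ e (e.symm z) (fderiv ℝ e.symm z a) = a := fun a => by
    have h1 := fderiv_comp z (he.differentiable (e.symm z))
      (hs.differentiable (by simp) z)
    have h2 : e ∘ e.symm = id := by ext <;> simp
    rw [h2, fderiv_id] at h1
    exact (DFunLike.congr_fun h1 a).symm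
  rw [← he.2 (e.symm z), h, h]

lemma HasBoundedLipschitzFDeriv.const_mul {g : ℝ → ℝ} (hg : HasBoundedLipschitzFDeriv g)
    (t : ℝ) : HasBoundedLipschitzFDeriv fun s => t * g s := by
  obtain ⟨hc, C, K, hK, hC, hL⟩ := hg
  have h : fderiv ℝ (fun s => t * g s) = fun s => t • fderiv ℝ g s := by
    ext1 s
    exact fderiv_const_mul (hc.differentiable (by simp) s) t
  refine ⟨contDiff_const.mul hc, |t| * C, |t| * K, by positivity, fun z => ?_, ?_⟩
  · rw [h, norm_smul, Real.norm_eq_abs]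
    gcongr
    exact hC z
  · intro z w
    simp only [h]
    rw [← smul_sub, norm_smul, Real.norm_eq_abs, mul_assoc]
    gcongr
    exact hL z w

/-- Near time `0`, the maps of a smooth family starting at the identity and fixing the complement
of a ball are `C¹`-close to the identity. -/
lemma exists_pos_forall_norm_fderiv_sub_id_le {E : Type*} [NormedAddCommGroup E]
    [NormedSpace ℝ E] [FiniteDimensional ℝ E] {F : ℝ → E → E}
    (hF : ContDiff ℝ ∞ fun q : ℝ × E => F q.1 q.2) (h0 : ∀ z, F 0 z = z) {ρ : ℝ}
    (hout : ∀ t z, ρ < ‖z‖ → F t z = z) {ε : ℝ} (hε : 0 < ε) :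
    ∃ δ > 0, ∀ t, |t| < δ → ∀ z, ‖fderiv ℝ (F t) z - ContinuousLinearMap.id ℝ E‖ ≤ ε := by
  let D : ℝ × E → E →L[ℝ] E := fun q =>
    (fderiv ℝ (fun q : ℝ × E => F q.1 q.2) q).comp (ContinuousLinearMap.inr ℝ ℝ E)
  have hD : ∀ t z, HasFDerivAt (F t) (D (t, z)) z := fun t z =>
    HasFDerivAt.comp (g := fun q : ℝ × E => F q.1 q.2) z
      (hF.differentiable (by simp) (t, z)).hasFDerivAt (hasFDerivAt_prodMk_right t z)
  have hDc : Continuous D :=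
    (hF.continuous_fderiv (by simp)).clm_comp continuous_const
  have hD0 : ∀ z, D (0, z) = ContinuousLinearMap.id ℝ E := fun z => by
    rw [← (hD 0 z).fderiv, show F 0 = id from funext h0, fderiv_id]
  have hU : IsOpen {q : ℝ × E | ‖D q - ContinuousLinearMap.id ℝ E‖ < ε} :=
    isOpen_lt (by fun_prop) continuous_const
  have : ProperSpace E := FiniteDimensional.proper ℝ E
  obtain ⟨u, v, hu, -, hu0, hv, huv⟩ := generalized_tube_lemma (isCompact_singleton (x := (0 : ℝ)))
    (isCompact_closedBall (0 : E) ρ) hU (by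
      rintro ⟨t, z⟩ ⟨ht, -⟩
      obtain rfl : t = 0 := ht
      simp [hD0, hε])
  obtain ⟨δ, hδ, hδu⟩ := Metric.isOpen_iff.1 hu 0 (hu0 rfl)
  refine ⟨δ, hδ, fun t ht z => ?_⟩
  by_cases hz : ‖z‖ ≤ ρ
  · rw [(hD t z).fderiv]
    exact le_of_lt (huv (mk_mem_prod (hδu (by simpa using ht)) (hv (by simpa using hz))))
  · have : F t =ᶠ[𝓝 z] id := by
      filter_upwards [(isOpen_lt continuous_const continuous_norm).mem_nhds (not_le.1 hz)] with x hx
      exact hout t x hx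
    rw [this.fderiv_eq, fderiv_id]
    simpa using hε.le

/-- A homeomorphism that moves the sphere of radius `ρ` off the ball of radius `R` and maps the
centre into that ball keeps the exterior regions apart. -/
lemma Homeomorph.lt_norm_of_lt_norm {E : Type*} [NormedAddCommGroup E] [NormedSpace ℝ E]
    (e : E ≃ₜ E) {ρ R : ℝ} (hρ : 0 < ρ) (h0 : ‖e 0‖ ≤ R) (hs : ∀ z, ‖z‖ = ρ → R < ‖e z‖)
    {z : E} (hz : ρ < ‖z‖) : R < ‖e z‖ := by
  by_contra! h
  have hconn : IsPreconnected (e.symm '' Metric.closedBall 0 R) :=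
    ((convex_closedBall (0 : E) R).isPreconnected).image _ e.symm.continuous.continuousOn
  obtain ⟨w, ⟨v, hv, rfl⟩, hw⟩ := hconn.intermediate_value (a := (0 : E)) (b := z)
    ⟨e 0, by simpa using h0, by simp⟩ ⟨e z, by simpa using h, by simp⟩
    continuous_norm.continuousOn (show ρ ∈ Icc ‖(0 : E)‖ ‖z‖ by simp [hρ.le, hz.le])
  have := hs _ hw
  simp only [Homeomorph.apply_symm_apply] at this
  exact absurd (by simpa using hv) (not_le.2 this)

/-- Intersection theorem for a compactly supported canonical flow conjugated by a linear
isomorphism that is a locally uniform limit of canonical diffeomorphisms. -/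
theorem exists_conj_flow_snd_eq_zero [FiniteDimensional ℝ V] (Φ : ℕ → V × V ≃ V × V)
    (hΦ : ∀ k, IsCanonicalMap (Φ k)) (hΦs : ∀ k, ContDiff ℝ ∞ (Φ k).symm)
    (L : (V × V) ≃L[ℝ] V × V)
    (hlim : TendstoLocallyUniformly (fun k z => Φ k z) L atTop) {ψ : ℝ → V × V → V × V}
    (hψ : ContDiff ℝ ∞ fun q : ℝ × (V × V) => ψ q.1 q.2) (hψc : ∀ t, IsCanonicalMap (ψ t))
    (hψ0 : ∀ z, ψ 0 z = z) (hψadd : ∀ s t z, ψ (s + t) z = ψ s (ψ t z)) {R : ℝ}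
    (hψR : ∀ t z, R < ‖z‖ → ψ t z = z) {u : V} (hu : ‖u‖ = 1) :
    ∃ ℓ > 0, ∀ g : ℝ → ℝ, HasBoundedLipschitzFDeriv g → (∀ s, g (s + ℓ) = g s) → ∀ t : ℝ,
      ∃ s p, |s| ≤ ℓ / 2 ∧ ⟪p, u⟫ = -(t * fderiv ℝ g s 1) ∧
        (L.symm (ψ t (L (s • u, p)))).2 = 0 := by
  wlog hR : 1 ≤ R generalizing R
  · exact this (R := 1) (fun t z hz => hψR t z ((not_le.1 hR).trans hz)) le_rfl
  have hpr : ProperSpace (V × V) := FiniteDimensional.proper ℝ _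
  obtain ⟨c, hc, hLc⟩ : ∃ c > 0, ∀ z, c * ‖z‖ ≤ ‖L z‖ := by
    refine ⟨(‖(L.symm : V × V →L[ℝ] V × V)‖ + 1)⁻¹, by positivity, fun z => ?_⟩
    rw [inv_mul_le_iff₀ (by positivity)]
    calc ‖z‖ = ‖(L.symm : V × V →L[ℝ] V × V) (L z)‖ := by simp
      _ ≤ ‖(L.symm : V × V →L[ℝ] V × V)‖ * ‖L z‖ := ContinuousLinearMap.le_opNorm _ _
      _ ≤ _ := by gcongr; linarith
  obtain ⟨ρ, hρ, hρR⟩ : ∃ ρ > 0, R + 1 < c * ρ := by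
    refine ⟨(R + 2) / c, by positivity, ?_⟩
    rw [mul_div_cancel₀ _ hc.ne']; linarith
  refine ⟨4 * ρ, by positivity, fun g hg hper t => ?_⟩
  have hclose : ∀ᶠ k in atTop, ∀ z ∈ Metric.closedBall (0 : V × V) ρ, dist (L z) (Φ k z) < 1 :=
    Metric.tendstoUniformlyOn_iff.1 ((tendstoLocallyUniformlyOn_iff_tendstoUniformlyOn_of_compact
      (isCompact_closedBall (0 : V × V) ρ)).1 hlim.tendstoLocallyUniformlyOn) 1 one_pos
  have hΦc : ∀ k, Continuous (Φ k) := fun k => (hΦ k).1.continuous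
  have hfar : ∀ᶠ k in atTop, ∀ z, ρ < ‖z‖ → R < ‖Φ k z‖ := by
    filter_upwards [hclose] with k hk z hz
    let e : V × V ≃ₜ V × V := ⟨Φ k, hΦc k, (hΦs k).continuous⟩
    refine e.lt_norm_of_lt_norm hρ ?_ (fun w hw => ?_) hz
    · have := hk 0 (by simpa using hρ.le)
      simp only [map_zero, dist_zero_left] at this
      exact this.le.trans hR
    · have h1 := hk w (by simp [hw])
      have h2 := hLc w
      rw [dist_eq_norm] at h1
      have h3 := norm_sub_norm_le (L w) (Φ k w)
      rw [hw] at h2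
      change R < ‖Φ k w‖
      linarith
  have hneg : ∀ t z, ψ (-t) (ψ t z) = z := fun t z => by rw [← hψadd]; simp [hψ0]
  have hiter : ∀ (τ : ℝ) (N : ℕ) z, (ψ τ)^[N] z = ψ (N * τ) z := fun τ N z => by
    induction N with
    | zero => simp [hψ0]
    | succ N ih =>
      rw [Function.iterate_succ_apply', ih, ← hψadd]
      congr 1; push_cast; ring
  have key : ∀ᶠ k in atTop, ∃ s p v, |s| ≤ 4 * ρ / 2 ∧ ⟪p, u⟫ = -(t * fderiv ℝ g s 1) ∧
      v.2 = 0 ∧ Φ k v = ψ t (Φ k (s • u, p)) ∧ ‖(s • u, p)‖ ≤ 2 * ρ ∧ ‖v‖ ≤ 2 * ρ := by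
    filter_upwards [hfar] with k hk
    let F : ℝ → V × V → V × V := fun τ z => (Φ k).symm (ψ τ (Φ k z))
    have hFout : ∀ τ z, ρ < ‖z‖ → F τ z = z := fun τ z hz => by
      simp [F, hψR τ _ (hk z hz)]
    have hF : ContDiff ℝ ∞ fun q : ℝ × (V × V) => F q.1 q.2 :=
      (hΦs k).comp (hψ.comp (contDiff_fst.prodMk ((hΦ k).1.comp contDiff_snd)))
    obtain ⟨δ, hδ, hFδ⟩ := exists_pos_forall_norm_fderiv_sub_id_le hF (by simp [F, hψ0]) hFout
      (ε := 1 / 2) (by norm_num)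
    obtain ⟨N, hN⟩ := exists_nat_gt (|t| / δ)
    have hN0 : (0 : ℝ) < N := lt_of_le_of_lt (by positivity) hN
    have hNδ : |t / N| < δ := by
      rw [abs_div, Nat.abs_cast, div_lt_iff₀ hN0]
      rwa [div_lt_iff₀ hδ, mul_comm] at hN
    have hFN : ∀ z, (F (t / N))^[N] z = F t z := fun z => by
      have : Function.Semiconj (Φ k).symm (ψ (t / N)) (F (t / N)) := fun w => by simp [F]
      have h2 := (this.iterate_right N) (Φ k z)
      rw [hiter, mul_div_cancel₀ _ hN0.ne', Equiv.symm_apply_apply] at h2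
      exact h2.symm
    obtain ⟨s, p, hs, hp, hsp⟩ := IsCanonicalMap.exists_iterate_snd_eq_zero
      (((hΦ k).symm (hΦs k)).comp ((hψc (t / N)).comp (hΦ k))) hρ le_rfl
      (hFout (t / N)) (hFδ _ hNδ) hu N (hg.const_mul t) (fun s => by rw [hper])
    change ((F (t / N))^[N] _).2 = 0 at hsp
    rw [hFN] at hsp
    have hder : fderiv ℝ (fun s => t * g s) s 1 = t * fderiv ℝ g s 1 := by
      rw [fderiv_const_mul (hg.1.differentiable (by simp) s) t]; simp
    rw [hder] at hp
    have hz : ‖(s • u, p)‖ ≤ 2 * ρ := by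
      by_cases h : ρ < ‖(s • u, p)‖
      · rw [hFout _ _ h] at hsp
        simp only at hsp
        rw [Prod.norm_def, hsp, norm_smul, hu]
        simp only [Real.norm_eq_abs, mul_one, norm_zero, sup_le_iff]
        exact ⟨by linarith, by positivity⟩
      · linarith
    refine ⟨s, p, F t (s • u, p), hs, hp, hsp, by simp [F], hz, ?_⟩
    by_cases h : ρ < ‖F t (s • u, p)‖
    · have h2 := hFout (-t) _ h
      have h3 : F (-t) (F t (s • u, p)) = (s • u, p) := by simp [F, hneg]
      rw [← h2, h3]
      exact hz
    · linarith
  obtain ⟨K, hK⟩ := eventually_atTop.1 key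
  choose s p v hs hp hv hsv hz hvb using fun k : ℕ => hK (k + K) (by omega)
  let w : ℕ → (V × V) × V × V := fun k => ((s k • u, p k), v k)
  obtain ⟨⟨z', v'⟩, -, a, ha, hw⟩ := ((isCompact_closedBall (0 : V × V) (2 * ρ)).prod
    (isCompact_closedBall (0 : V × V) (2 * ρ))).tendsto_subseq (x := w)
    (fun k => ⟨by simpa [w] using hz k, by simpa [w] using hvb k⟩)
  obtain ⟨s', hs'm, b, hb, hs'⟩ := (isCompact_Icc (a := -(4 * ρ / 2)) (b := 4 * ρ / 2)).tendsto_subseq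
    (x := s ∘ a) (fun k => abs_le.1 (hs _))
  have hw' := hw.comp hb.tendsto_atTop
  have hzlim : Tendsto (fun j => ((s (a (b j))) • u, p (a (b j)))) atTop (𝓝 z') :=
    (continuous_fst.tendsto _).comp hw'
  have hvlim : Tendsto (fun j => v (a (b j))) atTop (𝓝 v') := (continuous_snd.tendsto _).comp hw'
  have hplim : Tendsto (fun j => p (a (b j))) atTop (𝓝 z'.2) :=
    (continuous_snd.tendsto _).comp hzlim
  have hz'1 : z'.1 = s' • u := tendsto_nhds_unique ((continuous_fst.tendsto _).comp hzlim)
    (hs'.smul_const u)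
  have hsub : Tendsto (fun j => a (b j) + K) atTop atTop :=
    (tendsto_add_atTop_nat K).comp (ha.comp hb).tendsto_atTop
  have hlim' : ∀ {x : ℕ → V × V} {x'}, Tendsto x atTop (𝓝 x') →
      Tendsto (fun j => Φ (a (b j) + K) (x j)) atTop (𝓝 (L x')) := fun {x x'} hx => by
    have h : TendstoLocallyUniformly (fun j z => Φ (a (b j) + K) z) L atTop := fun U hU y =>
      let ⟨T, hT, h⟩ := hlim U hU y
      ⟨T, hT, hsub.eventually h⟩
    exact h.tendsto_comp L.continuous.continuousAt hx
  have hψt : Continuous (ψ t) := (hψc t).1.continuous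
  have hLv : L v' = ψ t (L z') := by
    refine tendsto_nhds_unique (hlim' hvlim) ?_
    simp only [hsv]
    exact (hψt.tendsto _).comp (hlim' hzlim)
  have hz'e : (s' • u, z'.2) = z' := by rw [← hz'1]
  have hgc : Continuous fun s => fderiv ℝ g s 1 :=
    (hg.1.continuous_fderiv (by simp)).clm_apply continuous_const
  refine ⟨s', z'.2, abs_le.2 hs'm, ?_, ?_⟩
  · refine tendsto_nhds_unique (hplim.inner tendsto_const_nhds) ?_
    simp only [hp]
    exact (((hgc.tendsto s').comp hs').const_mul t).neg
  · rw [hz'e, ← hLv, L.symm_apply_apply]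
    refine tendsto_nhds_unique ((continuous_snd.tendsto _).comp hvlim) ?_
    simp [Function.comp_def, hv]

end

section

variable {V : Type*} [NormedAddCommGroup V] [InnerProductSpace ℝ V]

/-- The infinitesimal version of `exists_conj_flow_snd_eq_zero`. -/
theorem exists_fderiv_eq_inner_conj_generator [FiniteDimensional ℝ V] (Φ : ℕ → V × V ≃ V × V)
    (hΦ : ∀ k, IsCanonicalMap (Φ k)) (hΦs : ∀ k, ContDiff ℝ ∞ (Φ k).symm)
    (L : (V × V) ≃L[ℝ] V × V)
    (hlim : TendstoLocallyUniformly (fun k z => Φ k z) L atTop) {ψ : ℝ → V × V → V × V}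
    (hψ : ContDiff ℝ ∞ fun q : ℝ × (V × V) => ψ q.1 q.2) (hψc : ∀ t, IsCanonicalMap (ψ t))
    (hψ0 : ∀ z, ψ 0 z = z) (hψadd : ∀ s t z, ψ (s + t) z = ψ s (ψ t z)) {R : ℝ}
    (hψR : ∀ t z, R < ‖z‖ → ψ t z = z) {X : ℝ × (V × V) → V × V} (hX : Continuous X)
    (hψX : ∀ t z, HasDerivAt (fun τ => ψ τ z) (X (t, z)) t) {u : V} (hu : ‖u‖ = 1) :
    ∃ ℓ > 0, ∀ g : ℝ → ℝ, HasBoundedLipschitzFDeriv g → (∀ s, g (s + ℓ) = g s) →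
      ∃ s, |s| ≤ ℓ / 2 ∧ fderiv ℝ g s 1 = ⟪(L.symm (X (0, L (s • u, 0)))).2, u⟫ := by
  have hpr : ProperSpace (V × V) := FiniteDimensional.proper ℝ _
  obtain ⟨ℓ, hℓ, h⟩ := exists_conj_flow_snd_eq_zero Φ hΦ hΦs L hlim hψ hψc hψ0 hψadd hψR hu
  refine ⟨ℓ, hℓ, fun g hg hper => ?_⟩
  let t : ℕ → ℝ := fun j => 1 / ((j : ℝ) + 1)
  have ht : ∀ j, 0 < t j := fun j => by positivity
  have htlim : Tendsto t atTop (𝓝 0) := tendsto_one_div_add_atTop_nhds_zero_nat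
  choose s p hs hp hsp using fun j => h g hg hper (t j)
  have hf : ∀ (z : V × V) τ, HasDerivAt (fun τ => ⟪(L.symm (ψ τ (L z))).2, u⟫)
      ⟪(L.symm (X (τ, L z))).2, u⟫ τ := fun z τ => by
    have h1 := (L.symm.hasFDerivAt.comp_hasDerivAt τ (hψX τ (L z)))
    have h2 := (ContinuousLinearMap.snd ℝ V V).hasFDerivAt.comp_hasDerivAt τ h1
    have h3 := h2.inner ℝ (hasDerivAt_const τ u)
    simpa using h3
  have hex : ∀ j, ∃ τ ∈ Ioo 0 (t j),
      fderiv ℝ g (s j) 1 = ⟪(L.symm (X (τ, L (s j • u, p j)))).2, u⟫ := fun j => by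
    obtain ⟨τ, hτ, h⟩ := exists_hasDerivAt_eq_slope _ _ (ht j)
      (fun τ _ => (hf (s j • u, p j) τ).continuousAt.continuousWithinAt) (fun τ _ => hf _ τ)
    refine ⟨τ, hτ, ?_⟩
    rw [h, hsp j, hψ0, L.symm_apply_apply, hp]
    field_simp [(ht j).ne']
    simp
  choose τ hτ hτg using hex
  have hτlim : Tendsto τ atTop (𝓝 0) :=
    squeeze_zero (fun j => (hτ j).1.le) (fun j => (hτ j).2.le) htlim
  obtain ⟨C, hC⟩ : ∃ C, ∀ j, ‖(s j • u, p j)‖ ≤ C := by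
    refine ⟨max (ℓ / 2) (‖(L.symm : V × V →L[ℝ] V × V)‖ * R), fun j => ?_⟩
    by_cases hj : R < ‖L (s j • u, p j)‖
    · have := hsp j
      rw [hψR _ _ hj, L.symm_apply_apply] at this
      simp only at this
      rw [this, Prod.norm_def, norm_smul, hu]
      simp only [Real.norm_eq_abs, mul_one, norm_zero, sup_le_iff, le_sup_iff]
      exact Or.inl ⟨hs j, by positivity⟩
    · refine le_max_of_le_right ?_
      calc ‖(s j • u, p j)‖ = ‖(L.symm : V × V →L[ℝ] V × V) (L (s j • u, p j))‖ := by simp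
        _ ≤ ‖(L.symm : V × V →L[ℝ] V × V)‖ * ‖L (s j • u, p j)‖ :=
          ContinuousLinearMap.le_opNorm _ _
        _ ≤ _ := by gcongr; exact not_lt.1 hj
  obtain ⟨z, -, a, ha, hz⟩ := (isCompact_closedBall (0 : V × V) C).tendsto_subseq
    (x := fun j => (s j • u, p j)) (fun j => by simpa using hC j)
  obtain ⟨s', hs'm, b, hb, hs'⟩ := (isCompact_Icc (a := -(ℓ / 2)) (b := ℓ / 2)).tendsto_subseq
    (x := s ∘ a) (fun k => abs_le.1 (hs _))
  have hab : Tendsto (a ∘ b) atTop atTop := (ha.comp hb).tendsto_atTop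
  have hz' : Tendsto (fun j => (s (a (b j)) • u, p (a (b j)))) atTop (𝓝 z) :=
    hz.comp hb.tendsto_atTop
  have hz1 : z.1 = s' • u := tendsto_nhds_unique ((continuous_fst.tendsto _).comp hz')
    (hs'.smul_const u)
  have hz2 : z.2 = 0 := by
    have hcont : Continuous fun q : ℝ × (V × V) => (L.symm (ψ q.1 (L q.2))).2 :=
      continuous_snd.comp (L.symm.continuous.comp
        (hψ.continuous.comp (continuous_fst.prodMk (L.continuous.comp continuous_snd))))
    have h1 := (hcont.tendsto (0, z)).comp ((htlim.comp hab).prodMk_nhds hz')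
    simp only [hψ0, L.symm_apply_apply] at h1
    refine tendsto_nhds_unique h1 ?_
    simp [Function.comp_def, hsp]
  have hze : z = (s' • u, 0) := Prod.ext hz1 hz2
  refine ⟨s', abs_le.2 hs'm, ?_⟩
  have hgc : Continuous fun s => fderiv ℝ g s 1 :=
    (hg.1.continuous_fderiv (by simp)).clm_apply continuous_const
  have hcont : Continuous fun q : ℝ × (V × V) => ⟪(L.symm (X (q.1, L q.2))).2, u⟫ :=
    (continuous_snd.comp (L.symm.continuous.comp
      (hX.comp (continuous_fst.prodMk (L.continuous.comp continuous_snd))))).inner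
      continuous_const
  have h1 := (hcont.tendsto (0, z)).comp ((hτlim.comp hab).prodMk_nhds hz')
  rw [← hze]
  refine tendsto_nhds_unique ((hgc.tendsto s').comp hs') ?_
  refine h1.congr fun j => ?_
  exact (hτg _).symm

lemma HasBoundedLipschitzFDeriv.of_periodic {g : ℝ → ℝ} (hg : ContDiff ℝ 2 g) {ℓ : ℝ}
    (hℓ : 0 < ℓ) (hper : ∀ s, g (s + ℓ) = g s) : HasBoundedLipschitzFDeriv g := by
  have hper1 : ∀ s, fderiv ℝ g (s + ℓ) = fderiv ℝ g s := fun s => by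
    rw [← fderiv_comp_add_right]; simp only [hper]
  have hper2 : ∀ s, fderiv ℝ (fderiv ℝ g) (s + ℓ) = fderiv ℝ (fderiv ℝ g) s := fun s => by
    rw [← fderiv_comp_add_right]; simp only [hper1]
  have hb : ∀ {f : ℝ → ℝ}, Continuous f → (∀ s, f (s + ℓ) = f s) → ∃ C, ∀ s, f s ≤ C :=
    fun {f} hf hp => by
      obtain ⟨C, hC⟩ := (Function.Periodic.compact_of_continuous hp hℓ.ne' hf).bddAbove
      exact ⟨C, fun s => hC (mem_range_self s)⟩
  have hc1 : Continuous fun s => ‖fderiv ℝ g s‖ := (hg.continuous_fderiv (by simp)).norm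
  have hc2 : Continuous fun s => ‖fderiv ℝ (fderiv ℝ g) s‖ :=
    ((hg.fderiv_right (m := 1) (by norm_num)).continuous_fderiv (by simp)).norm
  obtain ⟨C, hC⟩ := hb hc1 fun s => by rw [hper1]
  obtain ⟨K, hK⟩ := hb hc2 fun s => by rw [hper2]
  exact .of_bounded hg hC hK

/-- A nonnegative continuous function that is positive at `0` strictly dominates the derivative
of some smooth periodic function over one period. -/
lemma exists_periodic_fderiv_lt {Y : ℝ → ℝ} (hY : Continuous Y) (hY0 : ∀ s, 0 ≤ Y s)
    (hpos : 0 < Y 0) {ℓ : ℝ} (hℓ : 0 < ℓ) :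
    ∃ g : ℝ → ℝ, HasBoundedLipschitzFDeriv g ∧ (∀ s, g (s + ℓ) = g s) ∧
      ∀ s, |s| ≤ ℓ / 2 → fderiv ℝ g s 1 < Y s := by
  obtain ⟨c, hc, hcY⟩ := exists_between hpos
  obtain ⟨δ', hδ', hδY⟩ := Metric.isOpen_iff.1 (isOpen_lt continuous_const hY) 0 hcY
  have hπ := Real.pi_pos
  obtain ⟨δ, hδ, hδℓ, hδδ⟩ : ∃ δ > 0, δ ≤ ℓ / 4 ∧ δ ≤ δ' := 
    ⟨min (ℓ / 4) δ', by positivity, min_le_left _ _, min_le_right _ _⟩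
  let θ : ℝ → ℝ := fun s => 2 * Real.pi / ℓ * s
  have hθ : ∀ s, |θ s| = 2 * Real.pi / ℓ * |s| := fun s => by
    rw [abs_mul, abs_of_pos (by positivity)]
  let c₀ := Real.cos (θ δ)
  have hθδ : 0 < θ δ ∧ θ δ ≤ Real.pi / 2 := by
    refine ⟨by positivity, ?_⟩
    calc θ δ ≤ 2 * Real.pi / ℓ * (ℓ / 4) := by simp only [θ]; gcongr
      _ = Real.pi / 2 := by field_simp; norm_num
  have hc₀ : 0 ≤ c₀ := Real.cos_nonneg_of_mem_Icc ⟨by linarith [hθδ.1], hθδ.2⟩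
  have hc₁ : c₀ < 1 := by
    have := Real.cos_lt_cos_of_nonneg_of_le_pi le_rfl (by linarith [hθδ.2]) hθδ.1
    rwa [Real.cos_zero] at this
  obtain ⟨lam, hl1, hlc⟩ : ∃ lam : ℝ, 1 < lam ∧ lam * c₀ < 1 := by
    refine ⟨2 / (1 + c₀), ?_, ?_⟩
    · rw [lt_div_iff₀ (by positivity)]; linarith
    · rw [div_mul_eq_mul_div, div_lt_one (by positivity)]; linarith
  have hden : ∀ s, 0 < lam - Real.cos (θ s) := fun s => by linarith [Real.cos_le_one (θ s)]
  let κ := c * (lam - 1) * ℓ / (2 * Real.pi)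
  have hκ : 0 < κ := by have := sub_pos.2 hl1; positivity
  have hg : ContDiff ℝ 2 fun s => κ * (Real.sin (θ s) / (lam - Real.cos (θ s))) := by
    refine contDiff_const.mul (ContDiff.div ?_ ?_ fun s => (hden s).ne')
    · exact Real.contDiff_sin.comp (contDiff_const.mul contDiff_id)
    · exact contDiff_const.sub (Real.contDiff_cos.comp (contDiff_const.mul contDiff_id))
  have hper : ∀ s, θ (s + ℓ) = θ s + 2 * Real.pi := fun s => by simp only [θ]; field_simp
  have hper' : ∀ s, κ * (Real.sin (θ (s + ℓ)) / (lam - Real.cos (θ (s + ℓ)))) =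
      κ * (Real.sin (θ s) / (lam - Real.cos (θ s))) := fun s => by
    rw [hper, Real.sin_add_two_pi, Real.cos_add_two_pi]
  have hder : ∀ s, fderiv ℝ (fun s => κ * (Real.sin (θ s) / (lam - Real.cos (θ s)))) s 1 =
      c * (lam - 1) * (lam * Real.cos (θ s) - 1) / (lam - Real.cos (θ s)) ^ 2 := fun s => by
    have h1 : HasDerivAt θ (2 * Real.pi / ℓ) s := by
      simpa using (hasDerivAt_id s).const_mul (2 * Real.pi / ℓ)
    have h2 := ((h1.sin.div (h1.cos.const_sub lam) (hden s).ne').const_mul κ).deriv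
    rw [fderiv_apply_one_eq_deriv]
    refine h2.trans ?_
    have := (hden s).ne'
    have h3 : Real.sin (θ s) ^ 2 = 1 - Real.cos (θ s) ^ 2 := Real.sin_sq _
    simp only [κ]
    field_simp
    linear_combination (1 - lam) * h3
  refine ⟨_, .of_periodic hg hℓ hper', hper', fun s hs => ?_⟩
  rw [hder]
  have hd := hden s
  have hl := sub_pos.2 hl1
  by_cases h : |s| < δ
  · refine lt_of_le_of_lt ?_ (hδY (by simpa using h.trans_le hδδ) : c < Y s)
    rw [div_le_iff₀ (by positivity), mul_assoc]
    have h1 := Real.cos_le_one (θ s)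
    refine mul_le_mul_of_nonneg_left ?_ hc.le
    calc (lam - 1) * (lam * Real.cos (θ s) - 1) ≤ (lam - 1) * (lam - 1) := by
          gcongr; nlinarith
      _ ≤ (lam - Real.cos (θ s)) ^ 2 := by rw [sq]; gcongr
  · refine lt_of_lt_of_le (div_neg_of_neg_of_pos ?_ (by positivity)) (hY0 s)
    refine mul_neg_of_pos_of_neg (by positivity) ?_
    have : Real.cos (θ s) ≤ c₀ := by
      rw [← Real.cos_abs, hθ]
      refine Real.cos_le_cos_of_nonneg_of_le_pi hθδ.1.le ?_ ?_
      · calc 2 * Real.pi / ℓ * |s| ≤ 2 * Real.pi / ℓ * (ℓ / 2) := by gcongr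
          _ = Real.pi := by field_simp
      · simp only [θ]; gcongr; exact not_lt.1 h
    nlinarith

end

section

variable {V : Type*} [NormedAddCommGroup V] [InnerProductSpace ℝ V]

/-- The standard complex structure on `V × V`. -/
noncomputable def quarterTurn (V : Type*) [NormedAddCommGroup V] [InnerProductSpace ℝ V] :
    V × V →L[ℝ] V × V :=
  (-ContinuousLinearMap.snd ℝ V V).prod (ContinuousLinearMap.fst ℝ V V)

@[simp]
lemma quarterTurn_apply (z : V × V) : quarterTurn V z = (-z.2, z.1) := rfl

/-- The Hamiltonian flow rotating `V × V` about `y` with angular speed `ρ (|z - y|²)`. -/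
noncomputable def rotationFlow (ρ : ℝ → ℝ) (y : V × V) (t : ℝ) (z : V × V) : V × V :=
  y + (Real.cos (t * ρ (⟪(z - y).1, (z - y).1⟫ + ⟪(z - y).2, (z - y).2⟫)) • (z - y) +
    Real.sin (t * ρ (⟪(z - y).1, (z - y).1⟫ + ⟪(z - y).2, (z - y).2⟫)) • quarterTurn V (z - y))

variable {ρ : ℝ → ℝ} (y : V × V)

lemma contDiff_rotationFlow (hρ : ContDiff ℝ ∞ ρ) :
    ContDiff ℝ ∞ fun q : ℝ × (V × V) => rotationFlow ρ y q.1 q.2 := by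
  have h : ContDiff ℝ ∞ fun q : ℝ × (V × V) =>
      q.1 * ρ (⟪(q.2 - y).1, (q.2 - y).1⟫ + ⟪(q.2 - y).2, (q.2 - y).2⟫) := by
    refine contDiff_fst.mul (hρ.comp (ContDiff.add ?_ ?_)) <;>
    exact ContDiff.inner ℝ (by fun_prop) (by fun_prop)
  have h1 : ContDiff ℝ ∞ fun q : ℝ × (V × V) => q.2 - y := by fun_prop
  exact contDiff_const.add ((h.cos.smul h1).add
    (h.sin.smul ((quarterTurn V).contDiff.comp h1)))

lemma hasFDerivAt_rotation {τ : V × V → ℝ} {T : V × V →L[ℝ] ℝ} {z : V × V}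
    (hτ : HasFDerivAt τ T z) :
    HasFDerivAt (fun z => y + (Real.cos (τ z) • (z - y) + Real.sin (τ z) • quarterTurn V (z - y)))
      ((Real.cos (τ z) • ContinuousLinearMap.id ℝ (V × V) +
        (-Real.sin (τ z) • T).smulRight (z - y)) + (Real.sin (τ z) • quarterTurn V +
        (Real.cos (τ z) • T).smulRight (quarterTurn V (z - y)))) z := by
  have h1 : HasFDerivAt (fun z : V × V => z - y) (ContinuousLinearMap.id ℝ _) z :=
    (hasFDerivAt_id z).sub_const y
  have h2 : HasFDerivAt (fun z : V × V => quarterTurn V (z - y)) (quarterTurn V) z :=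
    (quarterTurn V).hasFDerivAt.comp z h1
  exact ((hτ.cos.smul h1).add (hτ.sin.smul h2)).const_add y

lemma hasFDerivAt_inner_sub_add_inner_sub (z : V × V) :
    HasFDerivAt (fun z : V × V => ⟪(z - y).1, (z - y).1⟫ + ⟪(z - y).2, (z - y).2⟫)
      ((2 : ℝ) • ((innerSL ℝ (z - y).1).comp (ContinuousLinearMap.fst ℝ V V) +
        (innerSL ℝ (z - y).2).comp (ContinuousLinearMap.snd ℝ V V))) z := by
  have h1 : HasFDerivAt (fun z : V × V => (z - y).1) (ContinuousLinearMap.fst ℝ V V) z :=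
    hasFDerivAt_fst.sub_const y.1
  have h2 : HasFDerivAt (fun z : V × V => (z - y).2) (ContinuousLinearMap.snd ℝ V V) z :=
    hasFDerivAt_snd.sub_const y.2
  refine ((h1.inner ℝ h1).add (h2.inner ℝ h2)).congr_fderiv ?_
  ext a <;> simp [real_inner_comm, two_mul, inner_sub_right]

lemma ContDiff.comp_prodMk_left {E F : Type*} [NormedAddCommGroup E] [NormedSpace ℝ E]
    [NormedAddCommGroup F] [NormedSpace ℝ F] {n : WithTop ℕ∞} {f : ℝ → E → F}
    (hf : ContDiff ℝ n fun q : ℝ × E => f q.1 q.2) (t : ℝ) : ContDiff ℝ n (f t) :=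
  ContDiff.comp (g := fun q : ℝ × E => f q.1 q.2) hf (contDiff_const.prodMk contDiff_id)

lemma isCanonicalMap_rotationFlow (hρ : ContDiff ℝ ∞ ρ) (t : ℝ) :
    IsCanonicalMap (rotationFlow ρ y t) := by
  have hc : ContDiff ℝ ∞ (rotationFlow ρ y t) :=
    (contDiff_rotationFlow y hρ).comp_prodMk_left t
  refine ⟨hc, fun z a b => ?_⟩
  have h3 := ((hρ.differentiable (by simp) _).hasDerivAt.comp_hasFDerivAt z
    (hasFDerivAt_inner_sub_add_inner_sub y z)).const_mul t
  have h5 : fderiv ℝ (rotationFlow ρ y t) z = _ := (hasFDerivAt_rotation y h3).fderiv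
  rw [h5]
  simp only [Function.comp_apply]
  generalize deriv ρ (⟪(z - y).1, (z - y).1⟫ + ⟪(z - y).2, (z - y).2⟫) = k
  generalize t * ρ (⟪(z - y).1, (z - y).1⟫ + ⟪(z - y).2, (z - y).2⟫) = r
  obtain ⟨w₁, w₂⟩ := z - y
  obtain ⟨a₁, a₂⟩ := a
  obtain ⟨b₁, b₂⟩ := b
  simp only [canonicalForm, add_apply, smul_apply, ContinuousLinearMap.smulRight_apply,
    ContinuousLinearMap.comp_apply, ContinuousLinearMap.coe_fst', ContinuousLinearMap.coe_snd',
    ContinuousLinearMap.id_apply, innerSL_apply_apply, quarterTurn_apply, Prod.smul_mk,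
    Prod.mk_add_mk, smul_eq_mul]
  simp only [inner_add_left, inner_add_right, real_inner_smul_left, real_inner_smul_right,
    inner_neg_left, inner_neg_right]
  rw [real_inner_comm w₁ w₂, real_inner_comm b₁ a₁, real_inner_comm b₂ a₂,
    real_inner_comm b₁ a₂, real_inner_comm b₂ a₁]
  simp only [real_inner_comm w₁ a₁, real_inner_comm w₁ a₂, real_inner_comm w₂ a₁,
    real_inner_comm w₂ a₂]
  linear_combination (⟪b₂, a₁⟫ - ⟪b₁, a₂⟫) * Real.cos_sq_add_sin_sq r

lemma rotationFlow_zero (z : V × V) : rotationFlow ρ y 0 z = z := by simp [rotationFlow]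

lemma rotationFlow_add (s t : ℝ) (z : V × V) :
    rotationFlow ρ y (s + t) z = rotationFlow ρ y s (rotationFlow ρ y t z) := by
  set τ := ρ (⟪(z - y).1, (z - y).1⟫ + ⟪(z - y).2, (z - y).2⟫) with hτ
  have h1 : rotationFlow ρ y t z - y =
      Real.cos (t * τ) • (z - y) + Real.sin (t * τ) • quarterTurn V (z - y) := by
    rw [rotationFlow, add_sub_cancel_left]
  have h2 : ⟪(rotationFlow ρ y t z - y).1, (rotationFlow ρ y t z - y).1⟫ +
      ⟪(rotationFlow ρ y t z - y).2, (rotationFlow ρ y t z - y).2⟫ =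
      ⟪(z - y).1, (z - y).1⟫ + ⟪(z - y).2, (z - y).2⟫ := by
    rw [h1]
    obtain ⟨w₁, w₂⟩ := z - y
    simp only [quarterTurn_apply, Prod.fst_add, Prod.snd_add, Prod.smul_mk, inner_add_left,
      inner_add_right, real_inner_smul_left, real_inner_smul_right, inner_neg_left, inner_neg_right,
      real_inner_comm w₁ w₂]
    linear_combination (⟪w₁, w₁⟫ + ⟪w₂, w₂⟫) * Real.cos_sq_add_sin_sq (t * τ)
  conv_rhs => rw [rotationFlow, h2, h1]
  rw [rotationFlow, ← hτ, add_mul, Real.cos_add, Real.sin_add]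
  obtain ⟨w₁, w₂⟩ := z - y
  simp only [quarterTurn_apply, Prod.smul_mk, Prod.mk_add_mk]
  congr 1
  ext1 <;> simp only <;> module

lemma rotationFlow_of_eq_zero {t : ℝ} {z : V × V}
    (h : ρ (⟪(z - y).1, (z - y).1⟫ + ⟪(z - y).2, (z - y).2⟫) = 0) :
    rotationFlow ρ y t z = z := by
  rw [rotationFlow, h]
  simp

/-- The velocity field of `rotationFlow`. -/
noncomputable def rotationVelocity (ρ : ℝ → ℝ) (y : V × V) (q : ℝ × (V × V)) : V × V :=
  fderiv ℝ (fun q : ℝ × (V × V) => rotationFlow ρ y q.1 q.2) q (1, 0)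

lemma continuous_rotationVelocity (hρ : ContDiff ℝ ∞ ρ) : Continuous (rotationVelocity ρ y) :=
  ((contDiff_rotationFlow y hρ).continuous_fderiv (by simp)).clm_apply continuous_const

lemma HasFDerivAt.hasDerivAt_partial_fst {E F : Type*} [NormedAddCommGroup E] [NormedSpace ℝ E]
    [NormedAddCommGroup F] [NormedSpace ℝ F] {f : ℝ × E → F} {f' : ℝ × E →L[ℝ] F} {t : ℝ} {z : E}
    (hf : HasFDerivAt f f' (t, z)) : HasDerivAt (fun τ => f (τ, z)) (f' (1, 0)) t :=
  hf.comp_hasDerivAt t ((hasDerivAt_id t).prodMk (hasDerivAt_const t z))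

lemma hasDerivAt_rotationFlow (hρ : ContDiff ℝ ∞ ρ) (t : ℝ) (z : V × V) :
    HasDerivAt (fun τ => rotationFlow ρ y τ z) (rotationVelocity ρ y (t, z)) t :=
  ((contDiff_rotationFlow y hρ).differentiable (by simp) (t, z)).hasFDerivAt.hasDerivAt_partial_fst

lemma rotationVelocity_zero (hρ : ContDiff ℝ ∞ ρ) (z : V × V) :
    rotationVelocity ρ y (0, z) =
      ρ (⟪(z - y).1, (z - y).1⟫ + ⟪(z - y).2, (z - y).2⟫) • quarterTurn V (z - y) := by
  refine (hasDerivAt_rotationFlow y hρ 0 z).unique ?_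
  have h1 := (hasDerivAt_id (0 : ℝ)).mul_const
    (ρ (⟪(z - y).1, (z - y).1⟫ + ⟪(z - y).2, (z - y).2⟫))
  have h2 := ((h1.cos.smul_const (z - y)).add
    (h1.sin.smul_const (quarterTurn V (z - y)))).const_add y
  simpa [rotationFlow] using h2

end

section

variable {V : Type*} [NormedAddCommGroup V] [InnerProductSpace ℝ V]

lemma exists_forall_eq_canonicalForm [FiniteDimensional ℝ V] (f : V × V →L[ℝ] ℝ) :
    ∃ n, ∀ z, f z = canonicalForm n z := by
  have : CompleteSpace V := FiniteDimensional.complete ℝ V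
  refine ⟨((InnerProductSpace.toDual ℝ V).symm (f.comp (ContinuousLinearMap.inr ℝ V V)),
    -(InnerProductSpace.toDual ℝ V).symm (f.comp (ContinuousLinearMap.inl ℝ V V))), fun z => ?_⟩
  simp only [canonicalForm, inner_neg_left, InnerProductSpace.toDual_symm_apply,
    ContinuousLinearMap.comp_apply, ContinuousLinearMap.inr_apply, ContinuousLinearMap.inl_apply]
  rw [sub_neg_eq_add, ← map_add]
  simp

/-- If a linear isomorphism `L` is a locally uniform limit of canonical diffeomorphisms, then it
maps the annihilator of `(u, 0)` to the annihilator of `L (u, 0)`. -/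
theorem exists_inner_snd_eq_mul_canonicalForm [FiniteDimensional ℝ V] (Φ : ℕ → V × V ≃ V × V)
    (hΦ : ∀ k, IsCanonicalMap (Φ k)) (hΦs : ∀ k, ContDiff ℝ ∞ (Φ k).symm)
    (L : (V × V) ≃L[ℝ] V × V)
    (hlim : TendstoLocallyUniformly (fun k z => Φ k z) L atTop) {u : V} (hu : ‖u‖ = 1) :
    ∃ c, ∀ x : V × V, ⟪x.2, u⟫ = c * canonicalForm (L (u, 0)) (L x) := by
  by_contra! hne
  set b := L (u, 0) with hb
  let f : V × V →L[ℝ] ℝ := (innerSL ℝ u).comp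
    ((ContinuousLinearMap.snd ℝ V V).comp (L.symm : V × V →L[ℝ] V × V))
  have hf : ∀ w, f w = ⟪(L.symm w).2, u⟫ := fun w => real_inner_comm _ _
  obtain ⟨n, hn⟩ := exists_forall_eq_canonicalForm f
  have hpos : ∀ z : V × V, z ≠ 0 → 0 < ⟪z.1, z.1⟫ + ⟪z.2, z.2⟫ := fun z hz => by
    simp only [real_inner_self_eq_norm_sq]
    by_contra! h
    refine hz (Prod.ext ?_ ?_) <;> simp only [Prod.fst_zero, Prod.snd_zero] <;>
      rw [← norm_eq_zero] <;> nlinarith [norm_nonneg z.1, norm_nonneg z.2]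
  have hb0 : b ≠ 0 := by
    rw [hb, Ne, L.map_eq_zero_iff]
    intro h
    have : u = 0 := congrArg Prod.fst h
    simp [this] at hu
  set B := ⟪b.1, b.1⟫ + ⟪b.2, b.2⟫ with hB
  have hB0 : 0 < B := hpos b hb0
  set P := ⟪n.1, b.1⟫ + ⟪n.2, b.2⟫ with hP
  let β := P / B
  have hβ : β * B = P := div_mul_cancel₀ _ hB0.ne'
  let m := n - β • b
  have hm0 : m ≠ 0 := fun h => by
    obtain ⟨x, hx⟩ := hne β
    refine hx ?_
    have h1 := hf (L x)
    rw [L.symm_apply_apply, hn, sub_eq_zero.1 h] at h1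
    rw [← h1]
    simp only [canonicalForm, Prod.smul_fst, Prod.smul_snd, real_inner_smul_left]
    ring
  set D := ⟪m.1, m.1⟫ + ⟪m.2, m.2⟫ with hD
  have hD0 : 0 < D := hpos m hm0
  have hq : ∀ s : ℝ, ⟪(s • b - -m).1, (s • b - -m).1⟫ + ⟪(s • b - -m).2, (s • b - -m).2⟫ =
      s ^ 2 * B + D := fun s => by
    simp only [hD, hB, m, Prod.fst_sub, Prod.snd_sub, Prod.smul_fst, Prod.smul_snd, Prod.fst_neg,
      Prod.snd_neg, inner_sub_left, inner_sub_right, inner_neg_left, inner_neg_right,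
      real_inner_smul_left, real_inner_smul_right, real_inner_comm n.1 b.1, real_inner_comm n.2 b.2]
    rw [hB, hP] at hβ
    linear_combination (-2 * s) * hβ
  have hnq : ∀ s : ℝ, canonicalForm n (quarterTurn V (s • b - -m)) = s * P + D := fun s => by
    simp only [canonicalForm, quarterTurn_apply, hD, hP, m, Prod.fst_sub, Prod.snd_sub,
      Prod.smul_fst, Prod.smul_snd, Prod.fst_neg, Prod.snd_neg, inner_sub_left, inner_sub_right,
      inner_neg_right, real_inner_smul_left, real_inner_smul_right,
      real_inner_comm n.1 b.1, real_inner_comm n.2 b.2]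
    rw [hB, hP] at hβ
    linear_combination (-β) * hβ
  obtain ⟨a, ha, haP⟩ : ∃ a > 0, a * |P| < D := by
    refine ⟨D / (|P| + 1), by positivity, ?_⟩
    rw [div_mul_eq_mul_div, div_lt_iff₀ (by positivity)]
    linarith
  let ρ : ℝ → ℝ := fun τ => Real.smoothTransition (D + a ^ 2 * B - τ)
  have hρ : ContDiff ℝ ∞ ρ :=
    Real.smoothTransition.contDiff.comp (contDiff_const.sub contDiff_id)
  have hρ0 : ∀ τ, D + a ^ 2 * B ≤ τ → ρ τ = 0 := fun τ hτ =>
    Real.smoothTransition.zero_of_nonpos (by linarith)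
  have hout : ∀ t z, ‖m‖ + (D + a ^ 2 * B + 1) < ‖z‖ → rotationFlow ρ (-m) t z = z := by
    intro t z hz
    refine rotationFlow_of_eq_zero _ (hρ0 _ ?_)
    have h1 : D + a ^ 2 * B + 1 < ‖z - -m‖ := by
      have := norm_sub_norm_le z (-m)
      rw [norm_neg] at this
      linarith
    have h2 : 0 ≤ D + a ^ 2 * B := by positivity
    simp only [real_inner_self_eq_norm_sq]
    rw [Prod.norm_def] at h1
    rcases lt_max_iff.1 h1 with h | h <;>
      nlinarith [sq_nonneg ‖(z - -m).1‖, sq_nonneg ‖(z - -m).2‖]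
  obtain ⟨ℓ, hℓ, h⟩ := exists_fderiv_eq_inner_conj_generator Φ hΦ hΦs L hlim
    (contDiff_rotationFlow (-m) hρ) (isCanonicalMap_rotationFlow (-m) hρ) (rotationFlow_zero (-m))
    (rotationFlow_add (-m)) hout (continuous_rotationVelocity (-m) hρ)
    (hasDerivAt_rotationFlow (-m) hρ) hu
  let Y : ℝ → ℝ := fun s => ρ (s ^ 2 * B + D) * (s * P + D)
  have hY : ∀ s : ℝ, ⟪(L.symm (rotationVelocity ρ (-m) (0, L (s • u, 0)))).2, u⟫ = Y s :=
    fun s => by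
      have hs : L (s • u, 0) = s • b := by rw [hb, ← map_smul]; simp
      rw [rotationVelocity_zero _ hρ, ← hf, map_smul, hn, hs, hq, hnq, smul_eq_mul]
  have hYc : Continuous Y := by
    have := hρ.continuous
    fun_prop
  have hY0 : ∀ s, 0 ≤ Y s := fun s => by
    by_cases hs : a ^ 2 ≤ s ^ 2
    · simp only [Y]
      rw [hρ0 _ (by nlinarith), zero_mul]
    · have h1 : |s| < a := by
        rw [not_le] at hs
        exact abs_lt_of_sq_lt_sq hs ha.le
      refine mul_nonneg (Real.smoothTransition.nonneg _) ?_
      have h2 : |s * P| ≤ a * |P| := by rw [abs_mul]; gcongr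
      linarith [neg_abs_le (s * P)]
  have hYpos : 0 < Y 0 := by
    have : 0 < ρ (0 ^ 2 * B + D) := Real.smoothTransition.pos_of_pos (by
      have : 0 < a ^ 2 * B := by positivity
      linarith)
    simp only [Y]
    rw [zero_mul, zero_add]
    positivity
  obtain ⟨g, hg, hper, hlt⟩ := exists_periodic_fderiv_lt hYc hY0 hYpos hℓ
  obtain ⟨s, hs, hgs⟩ := h g hg hper
  rw [hY] at hgs
  exact (hlt s hs).ne hgs

end

section

variable {V : Type*} [NormedAddCommGroup V] [InnerProductSpace ℝ V]

section ComplexStructure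

variable {J : V →L[ℝ] V}

/-- The linear coordinates on `V × V` identifying the cotangent bundle of the diagonal with
`V × V` carrying the form `⟪J ·, ·⟫ ⊖ ⟪J ·, ·⟫`. -/
noncomputable def diagonalCoords (J : V →L[ℝ] V) (hJJ : ∀ x, J (J x) = -x) :
    (V × V) ≃L[ℝ] V × V :=
  ContinuousLinearEquiv.equivOfInverse
    ((ContinuousLinearMap.fst ℝ V V + (2⁻¹ : ℝ) • J.comp (ContinuousLinearMap.snd ℝ V V)).prod
      (ContinuousLinearMap.fst ℝ V V - (2⁻¹ : ℝ) • J.comp (ContinuousLinearMap.snd ℝ V V)))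
    (((2⁻¹ : ℝ) • (ContinuousLinearMap.fst ℝ V V + ContinuousLinearMap.snd ℝ V V)).prod
      (-J.comp (ContinuousLinearMap.fst ℝ V V - ContinuousLinearMap.snd ℝ V V)))
    (fun z => by
      ext1
      · simp; module
      · simp [hJJ]; module)
    (fun z => by
      ext1 <;> simp [hJJ] <;> module)

lemma diagonalCoords_apply (hJJ : ∀ x, J (J x) = -x) (z : V × V) : diagonalCoords J hJJ z =
    (z.1 + (2⁻¹ : ℝ) • J z.2, z.1 - (2⁻¹ : ℝ) • J z.2) := rfl

lemma canonicalForm_eq_sub (hJJ : ∀ x, J (J x) = -x) (hJ : ∀ x y, ⟪J x, y⟫ = -⟪x, J y⟫) (a b : V × V) : canonicalForm a b =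
    ⟪J (diagonalCoords J hJJ a).1, (diagonalCoords J hJJ b).1⟫ -
      ⟪J (diagonalCoords J hJJ a).2, (diagonalCoords J hJJ b).2⟫ := by
  simp only [diagonalCoords_apply, canonicalForm, map_add, map_sub, map_smul, hJJ, inner_add_left,
    inner_add_right, inner_sub_left, inner_sub_right, real_inner_smul_left, real_inner_smul_right,
    inner_neg_left]
  have h1 : ⟪J a.1, J b.2⟫ = ⟪a.1, b.2⟫ := by rw [hJ, hJJ, inner_neg_right, neg_neg]
  rw [h1]
  ring

/-- Linear `C⁰`-rigidity: a linear isomorphism that is a locally uniform limit of symplectic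
diffeomorphisms is symplectic. -/
theorem inner_apply_eq_of_tendstoLocallyUniformly [FiniteDimensional ℝ V]
    (hJJ : ∀ x, J (J x) = -x) (hJ : ∀ x y, ⟪J x, y⟫ = -⟪x, J y⟫) (Φ : ℕ → V ≃ V)
    (hΦ : ∀ k, ContDiff ℝ ∞ (Φ k)) (hΦs : ∀ k, ContDiff ℝ ∞ (Φ k).symm)
    (hΦJ : ∀ k z a b, ⟪J (fderiv ℝ (Φ k) z a), fderiv ℝ (Φ k) z b⟫ = ⟪J a, b⟫)
    (A : V ≃L[ℝ] V) (hlim : TendstoLocallyUniformly (fun k z => Φ k z) A atTop) (v w : V) :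
    ⟪J (A v), A w⟫ = ⟪J v, w⟫ := by
  let C := diagonalCoords J hJJ
  let Ψ : ℕ → V × V ≃ V × V := fun k =>
    (C.toEquiv.trans ((Φ k).prodCongr (Equiv.refl V))).trans C.symm.toEquiv
  have hΨ : ∀ k, IsCanonicalMap (Ψ k) := fun k => by
    refine ⟨C.symm.contDiff.comp ((((hΦ k).comp contDiff_fst).prodMk contDiff_snd).comp C.contDiff),
      fun z a b => ?_⟩
    have h1 : HasFDerivAt (fun z => (C z).1)
        ((ContinuousLinearMap.fst ℝ V V).comp (C : V × V →L[ℝ] V × V)) z :=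
      ((ContinuousLinearMap.fst ℝ V V).comp (C : V × V →L[ℝ] V × V)).hasFDerivAt
    have h2 : HasFDerivAt (fun z => (C z).2)
        ((ContinuousLinearMap.snd ℝ V V).comp (C : V × V →L[ℝ] V × V)) z :=
      ((ContinuousLinearMap.snd ℝ V V).comp (C : V × V →L[ℝ] V × V)).hasFDerivAt
    have h3 := HasFDerivAt.comp (g := Φ k) z
      ((hΦ k).differentiable (by simp) (C z).1).hasFDerivAt h1
    have h4 : HasFDerivAt (Ψ k) _ z := C.symm.hasFDerivAt.comp z (h3.prodMk h2)
    rw [h4.fderiv, canonicalForm_eq_sub hJJ hJ, canonicalForm_eq_sub hJJ hJ a b]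
    simp only [ContinuousLinearMap.comp_apply, ContinuousLinearMap.prod_apply,
      ContinuousLinearEquiv.coe_coe, ContinuousLinearMap.coe_fst', ContinuousLinearMap.coe_snd']
    have h5 : ∀ x, diagonalCoords J hJJ (C.symm x) = x := C.apply_symm_apply
    simp only [h5, hΦJ]
    rfl
  have hΨs : ∀ k, ContDiff ℝ ∞ (Ψ k).symm := fun k =>
    C.symm.contDiff.comp ((((hΦs k).comp contDiff_fst).prodMk contDiff_snd).comp C.contDiff)
  let L : (V × V) ≃L[ℝ] V × V :=
    (C.trans (A.prodCongr (ContinuousLinearEquiv.refl ℝ V))).trans C.symm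
  have hlim' : TendstoLocallyUniformly (fun k z => Ψ k z) L atTop := by
    have h1 : TendstoLocallyUniformly (fun k z => Φ k (C z).1) (fun z => A (C z).1) atTop :=
      hlim.comp (fun z => (C z).1) (continuous_fst.comp C.continuous)
    have h2 : TendstoLocallyUniformly (fun (_ : ℕ) z => (C z).2) (fun z => (C z).2) atTop :=
      fun U hU z => ⟨univ, univ_mem, .of_forall fun _ _ _ => refl_mem_uniformity hU⟩
    exact (C.symm : V × V →L[ℝ] V × V).uniformContinuous.comp_tendstoLocallyUniformly (h1.prodMk h2)
  have hLC : ∀ a, C (L a) = (A (C a).1, (C a).2) := fun a => C.apply_symm_apply _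
  have hunit : ∀ u v, ‖u‖ = 1 → ⟪J (A u), A v⟫ = ⟪J u, v⟫ := fun u v hu => by
    obtain ⟨c, hc⟩ := exists_inner_snd_eq_mul_canonicalForm Ψ hΨ hΨs L hlim' hu
    have hc' : ∀ x : V × V, ⟪x.2, u⟫ = c * (⟪J (A u), A (C x).1⟫ - ⟪J u, (C x).2⟫) := fun x => by
      rw [hc, canonicalForm_eq_sub hJJ hJ]
      change c * (⟪J (C (L _)).1, (C (L _)).1⟫ - ⟪J (C (L _)).2, (C (L _)).2⟫) = _
      simp [hLC, C, diagonalCoords_apply]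
    have h1 := hc' (v, 0)
    have h2 := hc' (0, u)
    have hc0 : c ≠ 0 := fun h => by simp [h, hu] at h2
    simp only [inner_zero_left, C, diagonalCoords_apply, map_zero, smul_zero, add_zero,
      sub_zero] at h1
    have h3 := (mul_eq_zero.1 h1.symm).resolve_left hc0
    linarith
  by_cases hv : v = 0
  · simp [hv]
  · have h1 := hunit (‖v‖⁻¹ • v) w (by rw [norm_smul, norm_inv, norm_norm, inv_mul_cancel₀]; simpa)
    simp only [map_smul, real_inner_smul_left] at h1
    exact mul_left_cancel₀ (inv_ne_zero (norm_ne_zero_iff.2 hv)) h1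

end ComplexStructure

end

/-- Conjugation of a bijection by homotheties: `z ↦ r • (e (x + r⁻¹ • z) - y)`. -/
noncomputable def Equiv.rescale {E : Type*} [NormedAddCommGroup E] [NormedSpace ℝ E] (e : E ≃ E)
    (x y : E) {r : ℝ} (hr : r ≠ 0) : E ≃ E where
  toFun z := r • (e (x + r⁻¹ • z) - y)
  invFun w := r • (e.symm (y + r⁻¹ • w) - x)
  left_inv z := by simp [smul_smul, hr]
  right_inv w := by simp [smul_smul, hr]

lemma hasFDerivAt_rescale {E : Type*} [NormedAddCommGroup E] [NormedSpace ℝ E] {e : E ≃ E}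
    {x y z : E} {r : ℝ} (hr : r ≠ 0) (he : DifferentiableAt ℝ e (x + r⁻¹ • z)) :
    HasFDerivAt (e.rescale x y hr) (fderiv ℝ e (x + r⁻¹ • z)) z := by
  have h1 : HasFDerivAt (fun z : E => x + r⁻¹ • z) (r⁻¹ • ContinuousLinearMap.id ℝ E) z :=
    ((hasFDerivAt_id z).const_smul r⁻¹).const_add x
  have h2 := ((he.hasFDerivAt.comp z h1).sub_const y).const_smul r
  refine h2.congr_fderiv ?_
  ext v
  simp [hr]

/-- `C⁰`-rigidity at a point of differentiability of the limit map. -/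
theorem inner_apply_eq_of_hasFDerivAt {V : Type*} [NormedAddCommGroup V] [InnerProductSpace ℝ V]
    [FiniteDimensional ℝ V] {J : V →L[ℝ] V}
    (hJJ : ∀ x, J (J x) = -x) (hJ : ∀ x y, ⟪J x, y⟫ = -⟪x, J y⟫) (Φ : ℕ → V ≃ V)
    (hΦ : ∀ k, ContDiff ℝ ∞ (Φ k)) (hΦs : ∀ k, ContDiff ℝ ∞ (Φ k).symm)
    (hΦJ : ∀ k z a b, ⟪J (fderiv ℝ (Φ k) z a), fderiv ℝ (Φ k) z b⟫ = ⟪J a, b⟫)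
    {φ : V → V} (hlim : ∀ K, IsCompact K → TendstoUniformlyOn (fun k z => Φ k z) φ atTop K)
    (A : V ≃L[ℝ] V) {x : V} (hφ : HasFDerivAt φ (A : V →L[ℝ] V) x) (v w : V) :
    ⟪J (A v), A w⟫ = ⟪J v, w⟫ := by
  have : ProperSpace V := FiniteDimensional.proper ℝ V
  let r : ℕ → ℝ := fun j => j + 1
  have hr : ∀ j, 0 < r j := fun j => by positivity
  have hk : ∀ j, ∃ k, ∀ z ∈ Metric.closedBall x 1, dist (φ z) (Φ k z) < (r j)⁻¹ ^ 2 := fun j =>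
    (Metric.tendstoUniformlyOn_iff.1 (hlim _ (isCompact_closedBall x 1)) _
      (by have := hr j; positivity)).exists
  choose k hk using hk
  let Ψ : ℕ → V ≃ V := fun j => (Φ (k j)).rescale x (φ x) (hr j).ne'
  refine inner_apply_eq_of_tendstoLocallyUniformly hJJ hJ Ψ (fun j => ?_) (fun j => ?_)
    (fun j z a b => ?_) A ?_ v w
  · exact contDiff_const.smul (((hΦ (k j)).comp
      (contDiff_const.add (contDiff_const.smul contDiff_id))).sub contDiff_const)
  · exact contDiff_const.smul (((hΦs (k j)).comp
      (contDiff_const.add (contDiff_const.smul contDiff_id))).sub contDiff_const)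
  · rw [(hasFDerivAt_rescale (hr j).ne' ((hΦ (k j)).differentiable (by simp) _)).fderiv, hΦJ]
  · refine Metric.tendstoLocallyUniformly_iff.2 fun ε hε z₀ =>
      ⟨Metric.ball z₀ 1, Metric.ball_mem_nhds _ one_pos, ?_⟩
    let R := ‖z₀‖ + 1
    have hR : 0 < R := by positivity
    have hrlim : Tendsto (fun j => (r j)⁻¹) atTop (𝓝 0) := by
      simpa [r] using tendsto_one_div_add_atTop_nhds_zero_nat (𝕜 := ℝ)
    obtain ⟨δ, hδ, hδφ⟩ := Metric.eventually_nhds_iff.1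
      ((hasFDerivAt_iff_isLittleO_nhds_zero.1 hφ).def (show 0 < ε / (2 * R) by positivity))
    have hRr : Tendsto (fun j => (r j)⁻¹ * R) atTop (𝓝 0) := by simpa using hrlim.mul_const R
    filter_upwards [hrlim.eventually_lt_const (show 0 < ε / 2 by positivity),
      hRr.eventually_lt_const (lt_min hδ one_pos)] with j hj1 hj2 z hz
    have hz : ‖z‖ ≤ R := by
      have := norm_le_norm_add_norm_sub' z z₀
      rw [Metric.mem_ball, dist_eq_norm] at hz
      simp only [R]
      linarith
    have hrj := hr j
    have hh : ‖(r j)⁻¹ • z‖ ≤ (r j)⁻¹ * R := by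
      rw [norm_smul, Real.norm_of_nonneg (by positivity)]
      gcongr
    have h1 := hk j (x + (r j)⁻¹ • z) (by
      rw [Metric.mem_closedBall, dist_eq_norm, add_sub_cancel_left]
      exact hh.trans (hj2.le.trans (min_le_right _ _)))
    have h2 := hδφ (y := (r j)⁻¹ • z) (by
      rw [dist_zero_right]
      exact hh.trans_lt (hj2.trans_le (min_le_left _ _)))
    rw [dist_eq_norm] at h1 ⊢
    have h3 : A z - Ψ j z = r j • (φ (x + (r j)⁻¹ • z) - Φ (k j) (x + (r j)⁻¹ • z)) -
        r j • (φ (x + (r j)⁻¹ • z) - φ x - (A : V →L[ℝ] V) ((r j)⁻¹ • z)) := by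
      simp only [Ψ, Equiv.rescale, Equiv.coe_fn_mk, map_smul, smul_sub, smul_smul,
        mul_inv_cancel₀ hrj.ne', one_smul, ContinuousLinearEquiv.coe_coe]
      abel
    have h4 : ‖r j • (φ (x + (r j)⁻¹ • z) - Φ (k j) (x + (r j)⁻¹ • z))‖ < ε / 2 := by
      rw [norm_smul, Real.norm_of_nonneg hrj.le]
      calc _ ≤ r j * (r j)⁻¹ ^ 2 := by gcongr
        _ = (r j)⁻¹ := by field_simp
        _ < ε / 2 := hj1
    have h5 : ‖r j • (φ (x + (r j)⁻¹ • z) - φ x - (A : V →L[ℝ] V) ((r j)⁻¹ • z))‖ ≤ ε / 2 := by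
      rw [norm_smul, Real.norm_of_nonneg hrj.le]
      calc _ ≤ r j * (ε / (2 * R) * ((r j)⁻¹ * R)) := by
            gcongr
            exact h2.trans (by gcongr)
        _ = ε / 2 := by field_simp
    rw [h3]
    linarith [norm_sub_le (r j • (φ (x + (r j)⁻¹ • z) - Φ (k j) (x + (r j)⁻¹ • z)))
      (r j • (φ (x + (r j)⁻¹ • z) - φ x - (A : V →L[ℝ] V) ((r j)⁻¹ • z)))]

/-- The equivalence sending the two copies of `Fin n` to the even and odd indices. -/
noncomputable def evenOddEquiv (n : ℕ) : Fin n ⊕ Fin n ≃ Fin (2 * n) :=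
  Equiv.ofBijective
    (Sum.elim (fun i => ⟨2 * i, by have := i.isLt; omega⟩)
      (fun i => ⟨2 * i + 1, by have := i.isLt; omega⟩))
    ((Fintype.bijective_iff_injective_and_card _).2 ⟨by
      rintro (i | i) (j | j) h <;> simp [Fin.ext_iff] at h ⊢ <;> omega, by simp; omega⟩)

/-- Coordinates on `ℝ^{2n}` splitting even and odd indices. -/
noncomputable def splitCoords (n : ℕ) :
    (Fin (2 * n) → ℝ) ≃L[ℝ] EuclideanSpace ℝ (Fin n ⊕ Fin n) :=
  ((LinearEquiv.funCongrLeft ℝ ℝ (evenOddEquiv n)).trans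
    (WithLp.linearEquiv 2 ℝ (Fin n ⊕ Fin n → ℝ)).symm).toContinuousLinearEquiv

/-- The complex structure on split coordinates. -/
noncomputable def splitComplexStructure (n : ℕ) :
    EuclideanSpace ℝ (Fin n ⊕ Fin n) →L[ℝ] EuclideanSpace ℝ (Fin n ⊕ Fin n) :=
  LinearMap.toContinuousLinearMap
    { toFun := fun v => WithLp.toLp 2
        (Sum.elim (fun i => -v (Sum.inr i)) (fun i => v (Sum.inl i)))
      map_add' := fun v w => by ext (i | i) <;> simp [add_comm]
      map_smul' := fun c v => by ext (i | i) <;> simp }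

lemma stdSymplecticForm_eq_inner (n : ℕ) (v w : Fin (2 * n) → ℝ) : stdSymplecticForm n v w =
    ⟪splitComplexStructure n (splitCoords n v), splitCoords n w⟫ := by
  simp only [stdSymplecticForm, PiLp.inner_apply, Fintype.sum_sum_type, ← Finset.sum_add_distrib]
  refine Finset.sum_congr rfl fun i _ => ?_
  simp [splitComplexStructure, splitCoords, evenOddEquiv, LinearEquiv.funCongrLeft]
  ring

lemma splitComplexStructure_sq (n : ℕ) (x) :
    splitComplexStructure n (splitComplexStructure n x) = -x := by
  ext (i | i) <;> simp [splitComplexStructure]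

lemma inner_splitComplexStructure (n : ℕ) (x y) :
    ⟪splitComplexStructure n x, y⟫ = -⟪x, splitComplexStructure n y⟫ := by
  simp only [PiLp.inner_apply, Fintype.sum_sum_type, splitComplexStructure]
  simp [Finset.sum_neg_distrib, add_comm]

lemma HasFDerivAt.conj_continuousLinearEquiv {E F : Type*} [NormedAddCommGroup E] [NormedSpace ℝ E] [NormedAddCommGroup F]
    [NormedSpace ℝ F] (T : E ≃L[ℝ] F) {f : E → E} {z : F} {f' : E →L[ℝ] E}
    (hf : HasFDerivAt f f' (T.symm z)) :
    HasFDerivAt (fun z => T (f (T.symm z)))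
      ((T : E →L[ℝ] F).comp (f'.comp (T.symm : F →L[ℝ] E))) z :=
  T.hasFDerivAt.comp z (hf.comp z T.symm.hasFDerivAt)

lemma exists_continuousLinearEquiv_hasFDerivAt {E : Type*} [NormedAddCommGroup E]
    [NormedSpace ℝ E] {f g : E → E} (hf : Differentiable ℝ f) (hg : Differentiable ℝ g)
    (hgf : Function.LeftInverse g f) (hfg : Function.RightInverse g f) (x : E) :
    ∃ A : E ≃L[ℝ] E, HasFDerivAt f (A : E →L[ℝ] E) x := by
  have h1 : (fderiv ℝ g (f x)).comp (fderiv ℝ f x) = ContinuousLinearMap.id ℝ E := by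
    rw [← fderiv_comp x (hg _) (hf _), show g ∘ f = id from funext hgf, fderiv_id]
  have h2 : (fderiv ℝ f x).comp (fderiv ℝ g (f x)) = ContinuousLinearMap.id ℝ E := by
    have := fderiv_comp (f x) (hf (g (f x))) (hg (f x))
    rwa [hgf x, show f ∘ g = id from funext hfg, fderiv_id, eq_comm] at this
  exact ⟨.equivOfInverse (fderiv ℝ f x) (fderiv ℝ g (f x)) (fun v => DFunLike.congr_fun h1 v)
    fun v => DFunLike.congr_fun h2 v, (hf x).hasFDerivAt⟩

lemma IsSymplectomorphism.of_tendstoUniformlyOn {n : ℕ}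
    {φseq : ℕ → (Fin (2 * n) → ℝ) → (Fin (2 * n) → ℝ)}
    (hseq : ∀ k, IsSymplectomorphism n (φseq k)) {φ : (Fin (2 * n) → ℝ) → (Fin (2 * n) → ℝ)}
    (hφ : IsSmoothDiffeo n φ) (hconv : ∀ K : Set (Fin (2 * n) → ℝ), IsCompact K →
      TendstoUniformlyOn (fun k => φseq k) φ atTop K) : IsSymplectomorphism n φ := by
  refine ⟨hφ, fun x v w => ?_⟩
  let T := splitCoords n
  obtain ⟨hφs, ψ, hψs, hψφ, hφψ⟩ := hφ
  obtain ⟨A, hA⟩ := exists_continuousLinearEquiv_hasFDerivAt (hφs.differentiable (by simp))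
    (hψs.differentiable (by simp)) hψφ hφψ x
  choose χ hχs hχφ hφχ using fun k => (hseq k).1.2
  let Φ : ℕ → EuclideanSpace ℝ (Fin n ⊕ Fin n) ≃ EuclideanSpace ℝ (Fin n ⊕ Fin n) := fun k =>
    (T.symm.toEquiv.trans ⟨φseq k, χ k, hχφ k, hφχ k⟩).trans T.toEquiv
  have hlim : ∀ K, IsCompact K →
      TendstoUniformlyOn (fun k z => Φ k z) (fun z => T (φ (T.symm z))) atTop K := fun K hK =>
    T.toContinuousLinearMap.uniformContinuous.comp_tendstoUniformlyOn
      (((hconv _ (hK.image T.symm.continuous)).comp T.symm).mono (subset_preimage_image _ _))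
  have hx : HasFDerivAt φ (A : (Fin (2 * n) → ℝ) →L[ℝ] (Fin (2 * n) → ℝ)) (T.symm (T x)) := by
    rwa [T.symm_apply_apply]
  have h := inner_apply_eq_of_hasFDerivAt (splitComplexStructure_sq n)
    (inner_splitComplexStructure n) Φ
    (fun k => T.contDiff.comp ((hseq k).1.1.comp T.symm.contDiff))
    (fun k => T.contDiff.comp ((hχs k).comp T.symm.contDiff)) (fun k z a b => ?_) hlim
    ((T.symm.trans A).trans T) (HasFDerivAt.conj_continuousLinearEquiv T hx) (T v) (T w)
  · rw [hA.fderiv, stdSymplecticForm_eq_inner, stdSymplecticForm_eq_inner]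
    simpa [T] using h
  · have h1 : HasFDerivAt (Φ k) _ z := HasFDerivAt.conj_continuousLinearEquiv T
      ((hseq k).1.1.differentiable (by simp) (T.symm z)).hasFDerivAt
    have h2 := (hseq k).2 (T.symm z) (T.symm a) (T.symm b)
    rw [stdSymplecticForm_eq_inner, stdSymplecticForm_eq_inner] at h2
    rw [h1.fderiv]
    simpa [T] using h2

end CZeroRigidity

/-- C⁰-rigidity of symplectomorphisms: if a sequence of symplectomorphisms of
`(ℝ^{2n}, ω₀)` converges uniformly on compact sets to a smooth diffeomorphism `φ`,
then `φ` is itself a symplectomorphism. -/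
theorem symplectomorphisms_C0_closed (n : ℕ) (hn : 1 ≤ n)
    (φseq : ℕ → (Fin (2 * n) → ℝ) → (Fin (2 * n) → ℝ))
    (hseq : ∀ k, IsSymplectomorphism n (φseq k))
    (φ : (Fin (2 * n) → ℝ) → (Fin (2 * n) → ℝ))
    (hφ : IsSmoothDiffeo n φ)
    (hconv : ∀ K : Set (Fin (2 * n) → ℝ), IsCompact K →
      TendstoUniformlyOn (fun k => φseq k) φ Filter.atTop K) :
    IsSymplectomorphism n φ := IsSymplectomorphism.of_tendstoUniformlyOn hseq hφ hconv
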